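/- arXiv:2406.17943 — 2 statements merged into one kernel-verified Lean document; each statement's English description precedes it below -/
import Mathlib

section
/- Any artinian Gorenstein algebra with h-vector (1, 4, 6, 6, 4, 1) over an algebraically closed field of characteristic zero has the strong Lefschetz property. -/
open MvPolynomial

noncomputable section

variable {K : Type*} [Field K] {n : ℕ}

/-- The degree `i` graded piece of the standard graded algebra `R/I`,
where `R = K[x_1,…,x_n]`. -/
def piece (I : Ideal (MvPolynomial (Fin n) K)) (i : ℕ) :
    Submodule K (MvPolynomial (Fin n) K ⧸ I) :=
  (homogeneousSubmodule (Fin n) K i).map (Ideal.Quotient.mkₐ K I).toLinearMap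

/-- The Hilbert function of the standard graded algebra `R/I`. -/
def hf (I : Ideal (MvPolynomial (Fin n) K)) (i : ℕ) : ℕ :=
  Module.finrank K (piece I i)

/-- `I` is a homogeneous ideal. -/
def IsHomogIdeal (I : Ideal (MvPolynomial (Fin n) K)) : Prop :=
  ∀ p ∈ I, ∀ i : ℕ, homogeneousComponent i p ∈ I

/-- The socle of `R/I`: the annihilator of the irrelevant maximal ideal. -/
def socle (I : Ideal (MvPolynomial (Fin n) K)) :
    Submodule K (MvPolynomial (Fin n) K ⧸ I) :=
  ⨅ j : Fin n, LinearMap.ker (LinearMap.mulLeft K (Ideal.Quotient.mk I (X j)))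

/-- `R/I` is a standard graded artinian Gorenstein algebra of socle degree `d`:
`I` is homogeneous, the Hilbert function vanishes above degree `d`, is symmetric,
and the socle is one-dimensional, concentrated in degree `d`. -/
def IsArtinianGorenstein (I : Ideal (MvPolynomial (Fin n) K)) (d : ℕ) : Prop :=
  IsHomogIdeal I ∧ hf I d = 1 ∧ (∀ i : ℕ, d < i → hf I i = 0) ∧
    (∀ i : ℕ, i ≤ d → hf I i = hf I (d - i)) ∧
    Module.finrank K (socle I) = 1 ∧ socle I ≤ piece I d

/-- The weak Lefschetz property for `R/I`: there is a linear form `ℓ` such that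
multiplication `×ℓ : [A]_i → [A]_{i+1}` has maximal rank (is injective or
surjective) for every `i`. -/
def WLP (I : Ideal (MvPolynomial (Fin n) K)) : Prop :=
  ∃ ℓ : MvPolynomial (Fin n) K, ℓ.IsHomogeneous 1 ∧ ∀ i : ℕ,
    (∀ a ∈ piece I i, Ideal.Quotient.mk I ℓ * a = 0 → a = 0) ∨
    (∀ b ∈ piece I (i + 1), ∃ a ∈ piece I i, Ideal.Quotient.mk I ℓ * a = b)

/-- The strong Lefschetz property for `R/I`: there is a linear form `ℓ` such that
`×ℓ^k : [A]_i → [A]_{i+k}` has maximal rank for all `i ≥ 0`, `k ≥ 1`. -/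
def SLP (I : Ideal (MvPolynomial (Fin n) K)) : Prop :=
  ∃ ℓ : MvPolynomial (Fin n) K, ℓ.IsHomogeneous 1 ∧ ∀ i k : ℕ, 1 ≤ k →
    ((∀ a ∈ piece I i, Ideal.Quotient.mk I ℓ ^ k * a = 0 → a = 0) ∨
     (∀ b ∈ piece I (i + k), ∃ a ∈ piece I i, Ideal.Quotient.mk I ℓ ^ k * a = b))

/-- The action of `p ∈ R = K[x_1,…,x_n]` on `S = K[X_1,…,X_n]` by differentiation,
`x_i` acting as `∂/∂X_i`. -/
def diffOp (p : MvPolynomial (Fin n) K) :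
    Module.End K (MvPolynomial (Fin n) K) :=
  ∑ m ∈ p.support, MvPolynomial.coeff m p •
    (List.ofFn fun j : Fin n =>
      ((pderiv j).toLinearMap : Module.End K (MvPolynomial (Fin n) K)) ^ (m j)).prod

/-- The degree-`d` graded piece of the inverse system `I^⊥ = {F : g ∘ F = 0 ∀ g ∈ I}`. -/
def invSys (I : Ideal (MvPolynomial (Fin n) K)) (d : ℕ) :
    Submodule K (MvPolynomial (Fin n) K) :=
  homogeneousSubmodule (Fin n) K d ⊓ ⨅ g ∈ I, LinearMap.ker (diffOp g)

end

set_option linter.unusedSectionVars false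

/-- Abstract data: the generic base change of a graded Gorenstein algebra with
`h = (1,4,6,6,4,1)`, with its generic linear form `l` and coefficient derivations. -/
structure GA (L A : Type*) [Field L] [CommRing A] [Algebra L A] where
  G : ℕ → Submodule L A
  mul_mem : ∀ {i j : ℕ} {a b : A}, a ∈ G i → b ∈ G j → a * b ∈ G (i + j)
  x : Fin 4 → A
  x_mem : ∀ i, x i ∈ G 1
  x_span : ∀ u ∈ G 1, ∃ c : Fin 4 → L, u = ∑ i, algebraMap L A (c i) * x i
  one_mem : (1 : A) ∈ G 0
  one_ne : (1 : A) ≠ 0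
  G2 : ∀ S : Submodule L A, (∀ u ∈ G 1, ∀ v ∈ G 1, u * v ∈ S) → G 2 ≤ S
  fr1 : Module.finrank L (G 1) = 4
  fr2 : Module.finrank L (G 2) = 6
  fr3 : Module.finrank L (G 3) = 6
  fr5 : Module.finrank L (G 5) = 1
  nd : ∀ {i : ℕ}, i < 5 → ∀ {a : A}, a ∈ G i → (∀ u ∈ G 1, a * u = 0) → a = 0
  l : A
  l_mem : l ∈ G 1
  d : Fin 4 → Derivation ℤ A A
  d_mem : ∀ (k : Fin 4) {i : ℕ} {a : A}, a ∈ G i → d k a ∈ G i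
  d_sc : ∀ (k : Fin 4) (c : L), ∃ c' : L, d k (algebraMap L A c) = algebraMap L A c'
  d_x : ∀ k j, d k (x j) = 0
  d_l : ∀ k, d k l = x k

namespace GA

variable {L A : Type*} [Field L] [CharZero L] [CommRing A] [Algebra L A] (g : GA L A)

/-- Derivations compatible with the grading and with scalars. -/
def IsGD (D : Derivation ℤ A A) : Prop :=
  (∀ {i : ℕ} {a : A}, a ∈ g.G i → D a ∈ g.G i) ∧
    ∀ c : L, ∃ c' : L, D (algebraMap L A c) = algebraMap L A c'

lemma isGD_d (k : Fin 4) : g.IsGD (g.d k) := ⟨g.d_mem k, g.d_sc k⟩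

lemma C_mul_mem {i : ℕ} {a : A} (c : L) (h : a ∈ g.G i) : algebraMap L A c * a ∈ g.G i := by
  rw [← Algebra.smul_def]; exact Submodule.smul_mem _ _ h

lemma exD {u : A} (hu : u ∈ g.G 1) : ∃ D : Derivation ℤ A A, g.IsGD D ∧ D g.l = u := by
  obtain ⟨c, hc⟩ := g.x_span u hu
  refine ⟨∑ i, algebraMap L A (c i) • g.d i, ⟨?_, ?_⟩, ?_⟩
  · intro i a ha
    simp only [Fin.sum_univ_four, Derivation.add_apply, Derivation.smul_apply, smul_eq_mul]
    exact Submodule.add_mem _ (Submodule.add_mem _ (Submodule.add_mem _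
      (g.C_mul_mem _ (g.d_mem _ ha)) (g.C_mul_mem _ (g.d_mem _ ha)))
      (g.C_mul_mem _ (g.d_mem _ ha))) (g.C_mul_mem _ (g.d_mem _ ha))
  · intro b
    choose f hf using fun k => g.d_sc k b
    refine ⟨c 0 * f 0 + c 1 * f 1 + c 2 * f 2 + c 3 * f 3, ?_⟩
    simp only [Fin.sum_univ_four, Derivation.add_apply, Derivation.smul_apply, smul_eq_mul, hf,
      map_add, map_mul]
  · simp only [Fin.sum_univ_four, Derivation.add_apply, Derivation.smul_apply, smul_eq_mul, hc,
      g.d_l]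

lemma canc (_g : GA L A) {z : A} (n : ℕ) (hn : n ≠ 0) (h : (n : A) * z = 0) : z = 0 := by
  have : (n : L) • z = 0 := by rw [Algebra.smul_def]; simpa using h
  rcases smul_eq_zero.mp this with h | h
  · exact absurd (Nat.cast_eq_zero.mp h) hn
  · exact h

lemma C_canc {z : A} {c : L} (hc : c ≠ 0) (h : algebraMap L A c * z = 0) : z = 0 := by
  rw [← Algebra.smul_def] at h
  exact (smul_eq_zero.mp h).resolve_left hc

lemma C_zero_or {z : A} {c : L} (hz : z ≠ 0) (h : algebraMap L A c * z = 0) : c = 0 := by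
  rw [← Algebra.smul_def] at h
  exact (smul_eq_zero.mp h).resolve_right hz

/-- four independent linear forms span -/
lemma span4 {a b c e : A} (ha : a ∈ g.G 1) (hb : b ∈ g.G 1) (hc : c ∈ g.G 1) (he : e ∈ g.G 1)
    (hli : ∀ α β γ δ : L, algebraMap L A α * a + algebraMap L A β * b + algebraMap L A γ * c
      + algebraMap L A δ * e = 0 → α = 0 ∧ β = 0 ∧ γ = 0 ∧ δ = 0) :
    ∀ u ∈ g.G 1, ∃ α β γ δ : L, u = algebraMap L A α * a + algebraMap L A β * b
      + algebraMap L A γ * c + algebraMap L A δ * e := by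
  let v : Fin 4 → g.G 1 := ![⟨a, ha⟩, ⟨b, hb⟩, ⟨c, hc⟩, ⟨e, he⟩]
  have hv : LinearIndependent L v := by
    rw [Fintype.linearIndependent_iff]
    intro f hf
    have h := congrArg (fun z : g.G 1 => (z : A)) hf
    simp only [Fin.sum_univ_four, v, Matrix.cons_val, Submodule.coe_add, Submodule.coe_smul, Submodule.coe_zero, Algebra.smul_def] at h
    obtain ⟨h0, h1, h2, h3⟩ := hli _ _ _ _ h
    intro i; fin_cases i <;> assumption
  have : FiniteDimensional L (g.G 1) := Module.finite_of_finrank_pos (by rw [g.fr1]; norm_num)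
  have hs := hv.span_eq_top_of_card_eq_finrank' (by simp [g.fr1])
  intro u hu
  have hm : (⟨u, hu⟩ : g.G 1) ∈ Submodule.span L (Set.range v) := by rw [hs]; trivial
  rw [Submodule.mem_span_range_iff_exists_fun] at hm
  obtain ⟨f, hf⟩ := hm
  refine ⟨f 0, f 1, f 2, f 3, ?_⟩
  have h := congrArg (fun z : g.G 1 => (z : A)) hf
  simp only [Fin.sum_univ_four, v, Matrix.cons_val, Submodule.coe_add, Submodule.coe_smul, Algebra.smul_def] at h
  exact h.symm

/-- `A_2` is not spanned by five elements. -/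
lemma no5 (s : Fin 5 → A)
    (h : ∀ u ∈ g.G 1, ∀ v ∈ g.G 1, u * v ∈ Submodule.span L (Set.range s)) : False := by
  have h1 := g.G2 _ h
  have : Module.Finite L (Submodule.span L (Set.range s)) := .span_of_finite L (Set.finite_range s)
  have h2 := Submodule.finrank_mono h1
  have h3 := finrank_range_le_card (R := L) s
  rw [g.fr2] at h2
  unfold Set.finrank at h3
  simp at h3
  omega

/-- products of a spanning quadruple suffice -/
lemma no5' (s : Fin 5 → A) {a b c e : A}
    (hsp : ∀ u ∈ g.G 1, ∃ α β γ δ : L, u = algebraMap L A α * a + algebraMap L A β * b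
      + algebraMap L A γ * c + algebraMap L A δ * e)
    (haa : a * a ∈ Submodule.span L (Set.range s)) (hab : a * b ∈ Submodule.span L (Set.range s))
    (hac : a * c ∈ Submodule.span L (Set.range s)) (hae : a * e ∈ Submodule.span L (Set.range s))
    (hbb : b * b ∈ Submodule.span L (Set.range s)) (hbc : b * c ∈ Submodule.span L (Set.range s))
    (hbe : b * e ∈ Submodule.span L (Set.range s)) (hcc : c * c ∈ Submodule.span L (Set.range s))
    (hce : c * e ∈ Submodule.span L (Set.range s)) (hee : e * e ∈ Submodule.span L (Set.range s)) :
    False := by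
  refine g.no5 s fun u hu v hv => ?_
  obtain ⟨α, β, γ, δ, rfl⟩ := hsp u hu
  obtain ⟨α', β', γ', δ', rfl⟩ := hsp v hv
  have key : ∀ (t : L) {z : A}, z ∈ Submodule.span L (Set.range s) →
      algebraMap L A t * z ∈ Submodule.span L (Set.range s) := by
    intro t z hz; rw [← Algebra.smul_def]; exact Submodule.smul_mem _ _ hz
  have := Submodule.add_mem _ (Submodule.add_mem _ (Submodule.add_mem _ (Submodule.add_mem _ (Submodule.add_mem _
    (key (α * α') haa) (key (α * β' + β * α') hab)) (key (α * γ' + γ * α') hac)) (key (α * δ' + δ * α') hae))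
    (Submodule.add_mem _ (key (β * β') hbb) (key (β * γ' + γ * β') hbc)))
    (Submodule.add_mem _ (Submodule.add_mem _ (key (β * δ' + δ * β') hbe) (key (γ * γ') hcc))
      (Submodule.add_mem _ (key (γ * δ' + δ * γ') hce) (key (δ * δ') hee)))
  convert this using 1
  simp only [map_add, map_mul]
  ring

lemma nd4 {i : ℕ} (hi : i < 5) {z a b c e : A} (hz : z ∈ g.G i)
    (hsp : ∀ u ∈ g.G 1, ∃ α β γ δ : L, u = algebraMap L A α * a + algebraMap L A β * b
      + algebraMap L A γ * c + algebraMap L A δ * e)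
    (ha : z * a = 0) (hb : z * b = 0) (hc : z * c = 0) (he : z * e = 0) : z = 0 := by
  refine g.nd hi hz fun u hu => ?_
  obtain ⟨α, β, γ, δ, rfl⟩ := hsp u hu
  linear_combination algebraMap L A α * ha + algebraMap L A β * hb + algebraMap L A γ * hc
    + algebraMap L A δ * he

/-- a nonzero element is not killed by some variable -/
lemma ex_x {i : ℕ} (hi : i < 5) {z : A} (hz : z ∈ g.G i) (h : z ≠ 0) : ∃ k, z * g.x k ≠ 0 := by
  by_contra! hc
  apply h
  refine g.nd hi hz fun u hu => ?_
  obtain ⟨c, rfl⟩ := g.x_span u hu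
  rw [Finset.mul_sum]
  refine Finset.sum_eq_zero fun k _ => ?_
  linear_combination algebraMap L A (c k) * hc k

lemma mem_pow (n : ℕ) : g.l ^ n ∈ g.G n := by
  induction n with
  | zero => simpa using g.one_mem
  | succ n ih => rw [pow_succ]; exact g.mul_mem ih g.l_mem

lemma l5 : g.l ^ 5 ≠ 0 := by
  have step : ∀ n, n < 5 → g.l ^ (n + 1) = 0 → g.l ^ n = 0 := by
    intro n hn h
    refine g.nd hn (g.mem_pow n) fun u hu => ?_
    obtain ⟨D, -, hD⟩ := g.exD hu
    have h2 := congrArg D h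
    rw [Derivation.leibniz_pow, hD, map_zero] at h2
    apply g.canc (n + 1) (by omega)
    simpa [nsmul_eq_mul] using h2
  intro h
  have := step 0 (by omega) (step 1 (by omega) (step 2 (by omega) (step 3 (by omega) (step 4 (by omega) h))))
  simp at this
  exact g.one_ne this

end GA

namespace GA

variable {L A : Type*} [Field L] [CharZero L] [CommRing A] [Algebra L A] (g : GA L A)

lemma five {D : Derivation ℤ A A} (hD : g.IsGD D) {m y y1 : A} {α β γ : L}
    (hDl : D g.l = m) (hDm : D m = 0) (hDy : D y = y1)
    (hDy1 : D y1 = algebraMap L A α * g.l + algebraMap L A β * y + algebraMap L A γ * y1)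
    (hα : α ≠ 0) (hyy : y * y = 0)
    (hsp : ∀ u ∈ g.G 1, ∃ a b c e : L, u = algebraMap L A a * g.l + algebraMap L A b * y
      + algebraMap L A c * y1 + algebraMap L A e * m) : False := by
  set C := algebraMap L A with hC
  set l := g.l with hl
  have e1 : y * y1 = 0 := by
    have h := congrArg D hyy
    simp only [Derivation.leibniz, smul_eq_mul, map_zero, hDy] at h
    exact g.canc 2 (by norm_num) (by push_cast; linear_combination h)
  have e2 : y1 * y1 = - C α * l * y := by
    have h := congrArg D e1
    simp only [Derivation.leibniz, smul_eq_mul, map_zero, hDy, hDy1] at h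
    linear_combination h - C β * hyy - C γ * e1
  obtain ⟨α', hα'⟩ := hD.2 α
  rw [← hC] at hα'
  -- my relation
  have e3 : C α * (m * y) = - 3 * C α * l * y1 + (2 * C γ * C α - C α') * l * y := by
    have h := congrArg D e2
    simp only [Derivation.leibniz, smul_eq_mul, map_neg, hDy, hDy1, hDl, hα'] at h
    linear_combination h - 2 * C β * e1 - 2 * C γ * e2
  obtain ⟨γ', hγ'⟩ := hD.2 γ
  obtain ⟨α'', hα''⟩ := hD.2 α'
  rw [← hC] at hγ' hα''
  have hinv : C α⁻¹ * C α = 1 := by rw [← map_mul, inv_mul_cancel₀ hα, map_one]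
  have h4inv : C (4⁻¹) * 4 = 1 := by
    have : C (4⁻¹) * C 4 = 1 := by rw [← map_mul, inv_mul_cancel₀ (by norm_num), map_one]
    rwa [map_ofNat] at this
  have e4 : 4 * C α * (m * y1) = - 3 * C α * l * (C α * l + C β * y + C γ * y1)
      - 3 * C α' * l * y1 - C α' * (m * y)
      + (2 * C γ' * C α + 2 * C γ * C α' - C α'') * l * y
      + (2 * C γ * C α - C α') * (m * y + l * y1) := by
    have h3 := e3
    rw [show (3 : A) = 1 + 1 + 1 by norm_num, show (2 : A) = 1 + 1 by norm_num] at h3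
    have h := congrArg D h3
    simp only [Derivation.leibniz, smul_eq_mul, map_neg, map_add, map_sub, Derivation.map_one_eq_zero, hDy, hDy1, hDl, hDm,
      hα', hγ', hα''] at h
    linear_combination h
  let s : Fin 5 → A := ![l * l, l * m, m * m, l * y, l * y1]
  set S := Submodule.span L (Set.range s)
  have key : ∀ (t : L) {z : A}, z ∈ S → C t * z ∈ S := by
    intro t z hz; rw [hC, ← Algebra.smul_def]; exact Submodule.smul_mem _ _ hz
  have s0 : l * l ∈ S := Submodule.subset_span ⟨0, rfl⟩
  have s1 : l * m ∈ S := Submodule.subset_span ⟨1, rfl⟩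
  have s2 : m * m ∈ S := Submodule.subset_span ⟨2, rfl⟩
  have s3 : l * y ∈ S := Submodule.subset_span ⟨3, rfl⟩
  have s4 : l * y1 ∈ S := Submodule.subset_span ⟨4, rfl⟩
  have smy : m * y ∈ S := by
    have h := S.add_mem (key (-3) s4) (key (α⁻¹ * (2 * γ * α - α')) s3)
    convert h using 1
    simp only [map_mul, map_sub, map_neg, map_ofNat]
    linear_combination C α⁻¹ * e3 + (-3 * l * y1 - m * y) * hinv
  have smy1 : m * y1 ∈ S := by
    have h := S.add_mem (S.add_mem (S.add_mem (key (-3 * α) s0) (key (-3 * β + α⁻¹ * (2 * γ' * α + 2 * γ * α' - α'')) s3))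
      (key (-3 * γ + α⁻¹ * (- 3 * α' + 2 * γ * α - α')) s4)) (key (α⁻¹ * (- α' + 2 * γ * α - α')) smy)
    have h := key 4⁻¹ h
    convert h using 1
    simp only [map_mul, map_sub, map_neg, map_ofNat, map_add]
    linear_combination C 4⁻¹ * C α⁻¹ * e4 - (m * y1) * h4inv -
      4 * C 4⁻¹ * (m * y1) * hinv + (-1) * C 4⁻¹ * 3 * l * (C α * l + C β * y + C γ * y1) * hinv 
  have z0 : ∀ {z : A}, z = 0 → z ∈ S := fun h => h ▸ S.zero_mem
  refine g.no5' s hsp s0 s3 s4 s1 (z0 hyy) (z0 e1) ?_ ?_ ?_ s2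
  · rw [mul_comm]; exact smy
  · have := key (-α) s3
    convert this using 1
    rw [map_neg]; linear_combination e2
  · rw [mul_comm]; exact smy1

lemma stable (h : ∀ y ∈ g.G 1, g.l ^ 3 * y = 0 → g.l ^ 2 * y = 0) :
    ∀ y ∈ g.G 1, g.l ^ 3 * y = 0 → y = 0 := by
  have h1 : ∀ y ∈ g.G 1, g.l ^ 3 * y = 0 → g.l * y = 0 := by
    intro y hy h3
    have h2 := h y hy h3
    refine g.nd (by norm_num) (g.mul_mem g.l_mem hy) fun u hu => ?_
    obtain ⟨D, hD, hDl⟩ := g.exD hu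
    have e3 := congrArg D (show g.l * g.l * g.l * y = 0 by linear_combination h3)
    have e2 := congrArg D (show g.l * g.l * y = 0 by linear_combination h2)
    simp only [Derivation.leibniz, smul_eq_mul, map_zero, hDl] at e2 e3
    have h4 := h (D y) (hD.1 hy) (by linear_combination e3 - 3 * u * h2)
    exact g.canc 2 (by norm_num) (by push_cast; linear_combination e2 - h4)
  intro y hy h3
  have h2 := h1 y hy h3
  refine g.nd (by norm_num) hy fun u hu => ?_
  obtain ⟨D, hD, hDl⟩ := g.exD hu
  have e3 := congrArg D (show g.l * g.l * g.l * y = 0 by linear_combination h3)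
  have e2 := congrArg D h2
  simp only [Derivation.leibniz, smul_eq_mul, map_zero, hDl] at e2 e3
  have h4 := h1 (D y) (hD.1 hy) (by linear_combination e3 - 3 * u * g.l * h2)
  linear_combination e2 - h4

/-- `ℓ² y y' = 0` on the kernel of `ℓ³`. -/
lemma ker_sq {y y' : A} (hy : y ∈ g.G 1) (hy' : y' ∈ g.G 1) (h : g.l ^ 3 * y = 0)
    (h' : g.l ^ 3 * y' = 0) : g.l ^ 2 * y * y' = 0 := by
  refine g.nd (by norm_num : 4 < 5) (g.mul_mem (g.mul_mem (g.mem_pow 2) hy) hy') fun u hu => ?_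
  obtain ⟨D, hD, hDl⟩ := g.exD hu
  have e3 := congrArg D (show g.l * g.l * g.l * y = 0 by linear_combination h)
  simp only [Derivation.leibniz, smul_eq_mul, map_zero, hDl] at e3
  exact g.canc 3 (by norm_num) (by push_cast; linear_combination y' * e3 - D y * h')

/-- `ker ℓ²` on `A_2` has dimension at most 2 when `ℓ²` is injective on `A_1`:
any three elements are dependent. -/
lemma E2 (h2 : ∀ y ∈ g.G 1, g.l ^ 2 * y = 0 → y = 0) {a b c : A} (ha : a ∈ g.G 2)
    (hb : b ∈ g.G 2) (hc : c ∈ g.G 2) (ha' : g.l ^ 2 * a = 0) (hb' : g.l ^ 2 * b = 0)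
    (hc' : g.l ^ 2 * c = 0) : ∃ α β γ : L, (α ≠ 0 ∨ β ≠ 0 ∨ γ ≠ 0) ∧
      algebraMap L A α * a + algebraMap L A β * b + algebraMap L A γ * c = 0 := by
  by_contra! hcon
  have fd1 : FiniteDimensional L (g.G 1) := Module.finite_of_finrank_pos (by rw [g.fr1]; norm_num)
  have fd2 : FiniteDimensional L (g.G 2) := Module.finite_of_finrank_pos (by rw [g.fr2]; norm_num)
  have fd5 : FiniteDimensional L (g.G 5) := Module.finite_of_finrank_pos (by rw [g.fr5]; norm_num)
  -- the map A_1 → Hom(A_2, A_5), u ↦ (b ↦ ℓ² u b)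
  let φ : g.G 1 →ₗ[L] (g.G 2 →ₗ[L] g.G 5) :=
    LinearMap.mk₂ L (fun u b => ⟨g.l ^ 2 * u.1 * b.1, g.mul_mem (g.mul_mem (g.mem_pow 2) u.2) b.2⟩)
      (by intros; ext; simp; ring) (by intros; ext; simp)
      (by intros; ext; simp; ring) (by intros; ext; simp)
  have hφ : Function.Injective φ := by
    refine (injective_iff_map_eq_zero φ).2 fun u hu => ?_
    have h : g.l ^ 2 * u.1 = 0 := by
      refine g.nd (by norm_num : 3 < 5) (g.mul_mem (g.mem_pow 2) u.2) fun v hv => ?_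
      refine g.nd (by norm_num : 4 < 5) (g.mul_mem (g.mul_mem (g.mem_pow 2) u.2) hv) fun w hw => ?_
      have := congrArg (fun f => ((f ⟨v * w, g.mul_mem hv hw⟩ : g.G 5) : A)) hu
      simp only [φ, LinearMap.mk₂_apply, LinearMap.zero_apply, Submodule.coe_zero] at this
      linear_combination this
    exact Subtype.ext (h2 _ u.2 h)
  let v : Fin 3 → g.G 2 := ![⟨a, ha⟩, ⟨b, hb⟩, ⟨c, hc⟩]
  have hv : LinearIndependent L v := by
    rw [Fintype.linearIndependent_iff]
    intro f hf
    have h := congrArg (fun z : g.G 2 => (z : A)) hf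
    simp only [Fin.sum_univ_three, v, Matrix.cons_val, Submodule.coe_add, Submodule.coe_smul,
      Submodule.coe_zero, Algebra.smul_def] at h
    have h' : ¬ (f 0 ≠ 0 ∨ f 1 ≠ 0 ∨ f 2 ≠ 0) := fun h'' => hcon _ _ _ h'' h
    push Not at h'
    intro i; fin_cases i
    · exact h'.1
    · exact h'.2.1
    · exact h'.2.2
  let W := Submodule.span L (Set.range v)
  have hW : Module.finrank L W = 3 := by rw [finrank_span_eq_card hv]; simp
  -- φ lands in functionals vanishing on W, i.e. factors through quotient
  have hker : ∀ u, W ≤ LinearMap.ker (φ u) := by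
    intro u
    rw [Submodule.span_le]
    rintro _ ⟨i, rfl⟩
    rw [SetLike.mem_coe, LinearMap.mem_ker]
    ext
    fin_cases i
    · simp [φ, v]; linear_combination u.1 * ha'
    · simp [φ, v]; linear_combination u.1 * hb'
    · simp [φ, v]; linear_combination u.1 * hc'
  let ψ : g.G 1 →ₗ[L] ((g.G 2 ⧸ W) →ₗ[L] g.G 5) :=
    { toFun := fun u => W.liftQ (φ u) (hker u)
      map_add' := by intro u u'; ext z; simp
      map_smul' := by intro r u; ext z; simp }
  have hψ : Function.Injective ψ := by
    intro u u' h
    apply hφ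
    ext z
    have := congrArg (fun f => ((f (W.mkQ z) : g.G 5) : A)) h
    simpa [ψ] using this
  have h3 := LinearMap.finrank_le_finrank_of_injective hψ
  rw [Module.finrank_linearMap, g.fr5, g.fr1] at h3
  have h4 := Submodule.finrank_quotient_add_finrank W
  rw [g.fr2, hW] at h4
  omega

end GA

set_option linter.unusedSectionVars false
namespace GA

variable {L A : Type*} [Field L] [CharZero L] [CommRing A] [Algebra L A] (g : GA L A)

/-- three linear forms do not span `A_1` -/
lemma ex4 (a b c : A) : ∃ m ∈ g.G 1, ∀ α β γ : L,
    m ≠ algebraMap L A α * a + algebraMap L A β * b + algebraMap L A γ * c := by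
  by_contra! h
  let s : Fin 3 → A := ![a, b, c]
  have h1 : g.G 1 ≤ Submodule.span L (Set.range s) := by
    intro m hm
    obtain ⟨α, β, γ, rfl⟩ := h m hm
    rw [Submodule.mem_span_range_iff_exists_fun]
    refine ⟨![α, β, γ], ?_⟩
    simp [Fin.sum_univ_three, s, Algebra.smul_def]
  have : Module.Finite L (Submodule.span L (Set.range s)) := .span_of_finite L (Set.finite_range s)
  have h2 := Submodule.finrank_mono h1
  have h3 := finrank_range_le_card (R := L) s
  rw [g.fr1] at h2
  unfold Set.finrank at h3
  simp at h3
  omega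

lemma dd {D : Derivation ℤ A A} {l m y y1 : A} (hDl : D l = m) (hDy : D y = y1) {z : A}
    (h : l ^ 3 * y = z) : 3 * l ^ 2 * m * y + l ^ 3 * y1 = D z := by
  have e3 := congrArg D (show l * l * l * y = z by linear_combination h)
  simp only [Derivation.leibniz, smul_eq_mul, hDl, hDy] at e3
  linear_combination e3

lemma inv_eq {C : L →+* A} {c : L} (hc : c ≠ 0) : C c⁻¹ * C c = 1 := by
  rw [← map_mul, inv_mul_cancel₀ hc, map_one]

lemma caseC {y y' y'' : A} (hy : y ∈ g.G 1) (hy' : y' ∈ g.G 1) (hy'' : y'' ∈ g.G 1)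
    (h : g.l ^ 3 * y = 0) (h' : g.l ^ 3 * y' = 0) (h'' : g.l ^ 3 * y'' = 0)
    (hn : g.l ^ 2 * y ≠ 0) (hn' : ∀ c : L, y' ≠ algebraMap L A c * y)
    (hn'' : ∀ b c : L, y'' ≠ algebraMap L A b * y + algebraMap L A c * y') : False := by
  apply hn
  refine g.nd4 (by norm_num : 3 < 5) (g.mul_mem (g.mem_pow 2) hy)
    (g.span4 g.l_mem hy hy' hy'' ?_) ?_ (g.ker_sq hy hy h h)
    (g.ker_sq hy hy' h h') (g.ker_sq hy hy'' h h'')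
  · intro α β γ δ e
    have hα : α = 0 := C_zero_or g.l5
      (by linear_combination g.l ^ 4 * e - algebraMap L A β * g.l * h
            - algebraMap L A γ * g.l * h' - algebraMap L A δ * g.l * h'')
    subst hα
    rw [map_zero] at e
    have hδ : δ = 0 := by
      by_contra hδ
      refine hn'' (-δ⁻¹ * β) (-δ⁻¹ * γ) ?_
      have := inv_eq (C := algebraMap L A) hδ
      simp only [map_mul, map_neg]
      linear_combination (algebraMap L A δ⁻¹) * e - y'' * this
    subst hδ
    rw [map_zero] at e
    have hγ : γ = 0 := by
      by_contra hγ
      refine hn' (-γ⁻¹ * β) ?_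
      have := inv_eq (C := algebraMap L A) hγ
      simp only [map_mul, map_neg]
      linear_combination (algebraMap L A γ⁻¹) * e - y' * this
    subst hγ
    rw [map_zero] at e
    refine ⟨rfl, C_zero_or hn (z := g.l ^ 2 * y) ?_, rfl, rfl⟩
    linear_combination g.l ^ 2 * e
  · linear_combination h

lemma caseB1 {y y' : A} (hy : y ∈ g.G 1) (hy' : y' ∈ g.G 1)
    (h : g.l ^ 3 * y = 0) (h' : g.l ^ 3 * y' = 0)
    (hn : g.l ^ 2 * y ≠ 0) (hn' : ∀ c : L, y' ≠ algebraMap L A c * y)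
    (h2 : ∀ y ∈ g.G 1, g.l ^ 2 * y = 0 → y = 0) : False := by
  have ind : ∀ β γ : L, algebraMap L A β * y + algebraMap L A γ * y' = 0 → β = 0 ∧ γ = 0 := by
    intro β γ e
    have hγ : γ = 0 := by
      by_contra hγ
      refine hn' (-γ⁻¹ * β) ?_
      have := inv_eq (C := algebraMap L A) hγ
      simp only [map_mul, map_neg]
      linear_combination (algebraMap L A γ⁻¹) * e - y' * this
    subst hγ
    rw [map_zero] at e
    refine ⟨C_zero_or hn (z := g.l ^ 2 * y) ?_, rfl⟩
    linear_combination g.l ^ 2 * e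
  have hE : ∀ w ∈ g.G 2, g.l ^ 2 * w = 0 → ∃ β γ : L,
      w = algebraMap L A β * (g.l * y) + algebraMap L A γ * (g.l * y') := by
    intro w hw hw2
    obtain ⟨β, γ, δ, hne, e⟩ := g.E2 h2 (g.mul_mem g.l_mem hy) (g.mul_mem g.l_mem hy') hw
      (by linear_combination h) (by linear_combination h') hw2
    have hδ : δ ≠ 0 := by
      rintro rfl
      rw [map_zero] at e
      have e0 := h2 (algebraMap L A β * y + algebraMap L A γ * y')
        (Submodule.add_mem _ (g.C_mul_mem _ hy) (g.C_mul_mem _ hy'))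
        (by linear_combination g.l * e)
      have := ind _ _ e0
      simp [this] at hne
    refine ⟨-δ⁻¹ * β, -δ⁻¹ * γ, ?_⟩
    have := inv_eq (C := algebraMap L A) hδ
    simp only [map_mul, map_neg]
    linear_combination (algebraMap L A δ⁻¹) * e - w * this
  have h3i : algebraMap L A 3⁻¹ * 3 = 1 := by
    have := inv_eq (C := algebraMap L A) (c := 3) (by norm_num)
    rwa [map_ofNat] at this
  have hP : ∀ u ∈ g.G 1, ∀ z ∈ g.G 1, g.l ^ 3 * z = 0 → ∃ v ∈ g.G 1, u * z = g.l * v := by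
    intro u hu z hz hz3
    obtain ⟨D, hD, hDl⟩ := g.exD hu
    have e := dd hDl rfl hz3
    rw [map_zero] at e
    have hmem : 3 * (u * z) + g.l * D z ∈ g.G 2 := by
      refine Submodule.add_mem _ ?_ (g.mul_mem g.l_mem (hD.1 hz))
      have := g.C_mul_mem 3 (g.mul_mem hu hz)
      rwa [map_ofNat] at this
    obtain ⟨β, γ, e2⟩ := hE _ hmem (by linear_combination e)
    refine ⟨algebraMap L A 3⁻¹ * (algebraMap L A β * y + algebraMap L A γ * y' - D z), ?_, ?_⟩
    · exact g.C_mul_mem _ (Submodule.sub_mem _ (Submodule.add_mem _ (g.C_mul_mem _ hy)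
        (g.C_mul_mem _ hy')) (hD.1 hz))
    · linear_combination algebraMap L A 3⁻¹ * e2 - u * z * h3i
  obtain ⟨m, hm, hmn⟩ := g.ex4 g.l y y'
  have hsp := g.span4 g.l_mem hy hy' hm (by
    intro α β γ δ e
    have hδ : δ = 0 := by
      by_contra hδ
      refine hmn (-δ⁻¹ * α) (-δ⁻¹ * β) (-δ⁻¹ * γ) ?_
      have := inv_eq (C := algebraMap L A) hδ
      simp only [map_mul, map_neg]
      linear_combination (algebraMap L A δ⁻¹) * e - m * this
    subst hδ
    rw [map_zero] at e
    have hα : α = 0 := C_zero_or g.l5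
      (by linear_combination g.l ^ 4 * e - algebraMap L A β * g.l * h
            - algebraMap L A γ * g.l * h')
    subst hα
    rw [map_zero] at e
    have := ind β γ (by linear_combination e)
    exact ⟨rfl, this.1, this.2, rfl⟩)
  let s : Fin 5 → A := ![g.l * g.l, g.l * y, g.l * y', g.l * m, m * m]
  set S := Submodule.span L (Set.range s)
  have key : ∀ (t : L) {z : A}, z ∈ S → algebraMap L A t * z ∈ S := by
    intro t z hz; rw [← Algebra.smul_def]; exact Submodule.smul_mem _ _ hz
  have s0 : g.l * g.l ∈ S := Submodule.subset_span ⟨0, rfl⟩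
  have s1 : g.l * y ∈ S := Submodule.subset_span ⟨1, rfl⟩
  have s2 : g.l * y' ∈ S := Submodule.subset_span ⟨2, rfl⟩
  have s3 : g.l * m ∈ S := Submodule.subset_span ⟨3, rfl⟩
  have s4 : m * m ∈ S := Submodule.subset_span ⟨4, rfl⟩
  have hl : ∀ u ∈ g.G 1, ∀ z ∈ g.G 1, g.l ^ 3 * z = 0 → u * z ∈ S := by
    intro u hu z hz hz3
    obtain ⟨v, hv, e⟩ := hP u hu z hz hz3
    obtain ⟨α, β, γ, δ, rfl⟩ := hsp v hv
    rw [e]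
    have := S.add_mem (S.add_mem (S.add_mem (key α s0) (key β s1)) (key γ s2)) (key δ s3)
    convert this using 1
    ring
  refine g.no5' s hsp s0 s1 s2 s3 (hl _ hy _ hy h) (hl _ hy _ hy' h') ?_ (hl _ hy' _ hy' h') ?_ s4
  · rw [mul_comm]; exact hl _ hm _ hy h
  · rw [mul_comm]; exact hl _ hm _ hy' h'

lemma caseB2 {y y0 : A} (hy : y ∈ g.G 1) (hyne : y ≠ 0)
    (h2 : g.l ^ 2 * y = 0) (hn : g.l ^ 2 * y0 ≠ 0)
    (hk : ∀ z ∈ g.G 1, g.l ^ 3 * z = 0 → ∃ b c : L, z = algebraMap L A b * y + algebraMap L A c * y0) :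
    False := by
  have hk2 : ∀ z ∈ g.G 1, g.l ^ 2 * z = 0 → ∃ b : L, z = algebraMap L A b * y := by
    intro z hz hz2
    obtain ⟨b, c, e⟩ := hk z hz (by linear_combination g.l * hz2)
    have : c = 0 := C_zero_or hn (by linear_combination hz2 - g.l ^ 2 * e - algebraMap L A b * h2)
    subst this
    exact ⟨b, by rw [e, map_zero]; ring⟩
  have d2 : ∀ (D : Derivation ℤ A A) (u : A), D g.l = u → 2 * g.l * u * y + g.l ^ 2 * D y = 0 := by
    intro D u hDl
    have e2 := congrArg D (show g.l * g.l * y = 0 by linear_combination h2)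
    simp only [Derivation.leibniz, smul_eq_mul, map_zero, hDl] at e2
    linear_combination e2
  have hly : g.l * y ≠ 0 := by
    intro hly
    apply hyne
    refine g.nd (by norm_num : 1 < 5) hy fun u hu => ?_
    obtain ⟨D, hD, hDl⟩ := g.exD hu
    have e2 := congrArg D hly
    simp only [Derivation.leibniz, smul_eq_mul, map_zero, hDl] at e2
    obtain ⟨b, hb⟩ := hk2 (D y) (hD.1 hy) (by linear_combination g.l * e2 - u * hly)
    linear_combination e2 - g.l * hb - algebraMap L A b * hly
  obtain ⟨k, hkm⟩ := g.ex_x (by norm_num : 2 < 5) (g.mul_mem g.l_mem hy) hly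
  obtain ⟨m, hm⟩ : ∃ m, m = g.x k := ⟨_, rfl⟩
  have hmG : m ∈ g.G 1 := hm ▸ g.x_mem k
  obtain ⟨D, hDe⟩ : ∃ D, D = g.d k := ⟨_, rfl⟩
  have hD : g.IsGD D := hDe ▸ g.isGD_d k
  have hDl : D g.l = m := by rw [hDe, hm, g.d_l]
  have hDm : D m = 0 := by rw [hDe, hm, g.d_x]
  rw [← hm] at hkm
  obtain ⟨y1, hDy⟩ : ∃ y1, D y = y1 := ⟨_, rfl⟩
  obtain ⟨y2, hDy1⟩ : ∃ y2, D y1 = y2 := ⟨_, rfl⟩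
  have hy1 : y1 ∈ g.G 1 := hDy ▸ hD.1 hy
  have hy2 : y2 ∈ g.G 1 := hDy1 ▸ hD.1 hy1
  have e1 := d2 D m hDl
  rw [hDy] at e1
  have l2y1 : g.l ^ 2 * y1 ≠ 0 := by
    intro h
    exact hkm (g.canc 2 (by norm_num) (by push_cast; linear_combination e1 - h))
  have l3y1 : g.l ^ 3 * y1 = 0 := by linear_combination g.l * e1 - 2 * m * h2
  -- rank one
  have rk : ∀ u ∈ g.G 1, ∃ c : L, g.l * y * u = algebraMap L A c * (g.l * y * m) := by
    intro u hu
    obtain ⟨D', hD', hDl'⟩ := g.exD hu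
    have e2 := d2 D' u hDl'
    obtain ⟨b, c, hbc⟩ := hk (D' y) (hD'.1 hy) (by linear_combination g.l * e2 - 2 * u * h2)
    obtain ⟨b1, c1, hbc1⟩ := hk y1 hy1 l3y1
    have hc1 : c1 ≠ 0 := by
      rintro rfl
      rw [map_zero] at hbc1
      exact l2y1 (by linear_combination g.l ^ 2 * hbc1 + algebraMap L A b1 * h2)
    refine ⟨c * c1⁻¹, ?_⟩
    have := inv_eq (C := algebraMap L A) hc1
    rw [map_mul, ← sub_eq_zero]
    refine g.canc 2 (by norm_num) ?_
    rw [Nat.cast_ofNat]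
    linear_combination e2 - g.l ^ 2 * hbc - algebraMap L A b * h2
      - algebraMap L A c * algebraMap L A c1⁻¹ * (e1 - g.l ^ 2 * hbc1 - algebraMap L A b1 * h2)
      + algebraMap L A c * g.l ^ 2 * y0 * this
  have lym2 : g.l * y * m * m ≠ 0 := by
    intro h
    apply hkm
    refine g.nd (by norm_num : 3 < 5) (g.mul_mem (g.mul_mem g.l_mem hy) hmG) fun u hu => ?_
    obtain ⟨c, hc⟩ := rk u hu
    linear_combination m * hc + algebraMap L A c * h
  have lyy : g.l * y * y = 0 := by
    refine g.nd (by norm_num : 3 < 5) (g.mul_mem (g.mul_mem g.l_mem hy) hy) fun u hu => ?_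
    obtain ⟨D', hD', hDl'⟩ := g.exD hu
    exact g.canc 2 (by norm_num) (by push_cast; linear_combination y * d2 D' u hDl' - D' y * h2)
  have dyy : ∀ (D : Derivation ℤ A A) (u : A), D g.l = u → u * y * y + 2 * g.l * y * D y = 0 := by
    intro D u hDl
    have e2 := congrArg D lyy
    simp only [Derivation.leibniz, smul_eq_mul, map_zero, hDl] at e2
    linear_combination e2
  have f1 := dyy D m hDl
  rw [hDy] at f1
  have f2 : g.l * m * y * y1 = 0 := by
    have := g.ker_sq hy1 hy1 l3y1 l3y1
    exact g.canc 2 (by norm_num) (by push_cast; linear_combination y1 * e1 - this)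
  have lyy1 : g.l * y * y1 = 0 := by
    obtain ⟨c, hc⟩ := rk y1 hy1
    have : c = 0 := C_zero_or lym2 (by linear_combination f2 - m * hc)
    rw [this, map_zero] at hc
    rw [hc]; ring
  have yy : y * y = 0 := by
    refine g.nd (by norm_num : 2 < 5) (g.mul_mem hy hy) fun u hu => ?_
    obtain ⟨c, hc⟩ := rk u hu
    have hn : u - algebraMap L A c * m ∈ g.G 1 := Submodule.sub_mem _ hu (g.C_mul_mem _ hmG)
    obtain ⟨D', hD', hDl'⟩ := g.exD hn
    obtain ⟨b, hb⟩ := hk2 (D' y) (hD'.1 hy) (by linear_combination d2 D' _ hDl' - 2 * hc)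
    have := dyy D' _ hDl'
    rw [hb] at this
    linear_combination this - 2 * algebraMap L A b * lyy + algebraMap L A c * f1
      - 2 * algebraMap L A c * lyy1
  have yy1 : y * y1 = 0 := by
    have h := congrArg D yy
    simp only [Derivation.leibniz, smul_eq_mul, map_zero, hDy] at h
    exact g.canc 2 (by norm_num) (by push_cast; linear_combination h)
  have y1y1 : y1 * y1 + y * y2 = 0 := by
    have h := congrArg D yy1
    simp only [Derivation.leibniz, smul_eq_mul, map_zero, hDy, hDy1] at h
    linear_combination h
  have e2 : g.l ^ 2 * y2 + 4 * g.l * m * y1 + 2 * m * m * y = 0 := by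
    have h := congrArg D (show g.l * m * y + g.l * m * y + g.l * g.l * y1 = 0 by linear_combination e1)
    simp only [Derivation.leibniz, smul_eq_mul, map_zero, map_add, hDl, hDm, hDy, hDy1] at h
    linear_combination h
  have f3 : g.l ^ 3 * y2 = 6 * (g.l * y * m * m) := by
    linear_combination g.l * e2 - 4 * m * e1
  have f4 : g.l * m * y * y2 = 0 :=
    g.canc 6 (by norm_num) (by
      push_cast; linear_combination -y1 * e2 + y2 * e1 + 4 * g.l * m * y1y1 + 2 * m * m * yy1)
  have hsp := g.span4 g.l_mem hy hy1 hmG (by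
    intro α β γ δ e
    have hδ : δ = 0 := C_zero_or hkm (by
      linear_combination g.l * y * e - algebraMap L A α * h2 - algebraMap L A β * g.l * yy
        - algebraMap L A γ * g.l * yy1)
    subst hδ
    rw [map_zero] at e
    have hα : α = 0 := C_zero_or g.l5
      (by linear_combination g.l ^ 4 * e - algebraMap L A β * g.l ^ 2 * h2
            - algebraMap L A γ * g.l * l3y1)
    subst hα
    rw [map_zero] at e
    have hγ : γ = 0 := C_zero_or l2y1
      (by linear_combination g.l ^ 2 * e - algebraMap L A β * h2)
    subst hγ
    rw [map_zero] at e
    exact ⟨rfl, C_zero_or hyne (by linear_combination e), rfl, rfl⟩)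
  obtain ⟨α, β, γ, δ, hy2e⟩ := hsp y2 hy2
  have hδ : δ = 0 := C_zero_or lym2 (by
      linear_combination f4 - g.l * m * y * hy2e - algebraMap L A α * m * h2
        - algebraMap L A β * m * g.l * yy - algebraMap L A γ * m * g.l * yy1)
  subst hδ
  rw [map_zero] at hy2e
  have hα : α ≠ 0 := by
    rintro rfl
    rw [map_zero] at hy2e
    refine lym2 (g.canc 6 (by norm_num) ?_)
    push_cast
    linear_combination -f3 + g.l ^ 3 * hy2e + algebraMap L A β * g.l * h2 + algebraMap L A γ * l3y1
  exact g.five (α := α) (β := β) (γ := γ) hD hDl hDm hDy (by rw [hDy1, hy2e]; ring) hα yy hsp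

end GA

set_option linter.unusedSectionVars false
namespace GA

variable {L A : Type*} [Field L] [CharZero L] [CommRing A] [Algebra L A] (g : GA L A)

lemma caseA {y : A} (hy : y ∈ g.G 1) (h3 : g.l ^ 3 * y = 0) (hn : g.l ^ 2 * y ≠ 0)
    (hk : ∀ z ∈ g.G 1, g.l ^ 3 * z = 0 → ∃ b : L, z = algebraMap L A b * y) : False := by
  have hyne : y ≠ 0 := by rintro rfl; simp at hn
  have l2yy : g.l ^ 2 * y * y = 0 := g.ker_sq hy hy h3 h3
  have r1 : ∀ (D : Derivation ℤ A A) (u : A), D g.l = u →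
      3 * g.l ^ 2 * u * y + g.l ^ 3 * D y = 0 := by
    intro D u hDl
    have := dd hDl rfl h3
    rwa [map_zero] at this
  have r4 : ∀ (D : Derivation ℤ A A) (u : A), D g.l = u →
      g.l * u * y * y + g.l ^ 2 * y * D y = 0 := by
    intro D u hDl
    have h := congrArg D (show g.l * g.l * y * y = 0 by linear_combination l2yy)
    simp only [Derivation.leibniz, smul_eq_mul, map_zero, hDl] at h
    exact g.canc 2 (by norm_num) (by push_cast; linear_combination h)
  have hP : ∀ (D : Derivation ℤ A A) (u : A), g.IsGD D → D g.l = u → g.l ^ 2 * y * u = 0 →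
      ∃ b : L, D y = algebraMap L A b * y := by
    intro D u hD hDl hu
    exact hk _ (hD.1 hy) (by linear_combination r1 D u hDl - 3 * hu)
  obtain ⟨Dy, hDy', hDyl⟩ := g.exD hy
  obtain ⟨lam, hlam⟩ := hP Dy y hDy' hDyl l2yy
  have ly3 : g.l * y * y * y = 0 := by
    linear_combination r4 Dy y hDyl - g.l ^ 2 * y * hlam - algebraMap L A lam * l2yy
  have r5 : ∀ (D : Derivation ℤ A A) (u : A), D g.l = u →
      u * y * y * y + 3 * g.l * y * y * D y = 0 := by
    intro D u hDl
    have h := congrArg D ly3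
    simp only [Derivation.leibniz, smul_eq_mul, map_zero, hDl] at h
    linear_combination h
  have y4 : y * y * y * y = 0 := by
    linear_combination r5 Dy y hDyl - 3 * g.l * y * y * hlam - 3 * algebraMap L A lam * ly3
  have r6 : ∀ (D : Derivation ℤ A A), y * y * y * D y = 0 := by
    intro D
    have h := congrArg D y4
    simp only [Derivation.leibniz, smul_eq_mul, map_zero] at h
    exact g.canc 4 (by norm_num) (by push_cast; linear_combination h)
  obtain ⟨k, hkm⟩ := g.ex_x (by norm_num : 3 < 5) (g.mul_mem (g.mem_pow 2) hy) hn
  obtain ⟨m, hm⟩ : ∃ m, m = g.x k := ⟨_, rfl⟩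
  have hmG : m ∈ g.G 1 := hm ▸ g.x_mem k
  obtain ⟨D, hDe⟩ : ∃ D, D = g.d k := ⟨_, rfl⟩
  have hD : g.IsGD D := hDe ▸ g.isGD_d k
  have hDl : D g.l = m := by rw [hDe, hm, g.d_l]
  have hDm : D m = 0 := by rw [hDe, hm, g.d_x]
  rw [← hm] at hkm
  obtain ⟨y1, hDy⟩ : ∃ y1, D y = y1 := ⟨_, rfl⟩
  obtain ⟨y2, hDy1⟩ : ∃ y2, D y1 = y2 := ⟨_, rfl⟩
  have hy1 : y1 ∈ g.G 1 := hDy ▸ hD.1 hy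
  have hy2 : y2 ∈ g.G 1 := hDy1 ▸ hD.1 hy1
  have e1 := r1 D m hDl
  have e4 := r4 D m hDl
  have e5 := r5 D m hDl
  have e6 := r6 D
  rw [hDy] at e1 e4 e5 e6
  by_cases hrk : ∀ u ∈ g.G 1, ∃ c : L, g.l ^ 2 * y * u = algebraMap L A c * (g.l ^ 2 * y * m)
  swap
  · push Not at hrk
    obtain ⟨u, hu, hun⟩ := hrk
    obtain ⟨D', hD', hDl'⟩ := g.exD hu
    obtain ⟨yu, hyu⟩ : ∃ y1, D' y = y1 := ⟨_, rfl⟩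
    have hyuG : yu ∈ g.G 1 := hyu ▸ hD'.1 hy
    have e1' := r1 D' u hDl'
    have e4' := r4 D' u hDl'
    have e6' := r6 D'
    have e5' := r5 D' u hDl'
    rw [hyu] at e1' e4' e6' e5'
    have hsp := g.span4 g.l_mem hy hy1 hyuG (by
      intro α β γ δ e
      have hα : α = 0 := C_zero_or g.l5
        (by linear_combination g.l ^ 4 * e - algebraMap L A β * g.l * h3
              - algebraMap L A γ * (g.l * e1 - 3 * m * h3)
              - algebraMap L A δ * (g.l * e1' - 3 * u * h3))
      subst hα
      rw [map_zero] at e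
      have e' : algebraMap L A γ * (g.l ^ 2 * y * m) + algebraMap L A δ * (g.l ^ 2 * y * u) = 0 :=
        g.canc 3 (by norm_num) (by
          rw [Nat.cast_ofNat]
          linear_combination - g.l ^ 3 * e + algebraMap L A β * h3 + algebraMap L A γ * e1
            + algebraMap L A δ * e1')
      have hδ : δ = 0 := by
        by_contra hδ
        apply hun (-δ⁻¹ * γ)
        have := inv_eq (C := algebraMap L A) hδ
        simp only [map_mul, map_neg]
        linear_combination (algebraMap L A δ⁻¹) * e' - (g.l ^ 2 * y * u) * this
      subst hδ
      rw [map_zero] at e e'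
      have hγ : γ = 0 := C_zero_or hkm (by linear_combination e')
      subst hγ
      rw [map_zero] at e
      exact ⟨rfl, C_zero_or hyne (by linear_combination e), rfl, rfl⟩)
    have yyy : y * y * y = 0 := g.nd4 (by norm_num : 3 < 5) (g.mul_mem (g.mul_mem hy hy) hy) hsp
      (by linear_combination ly3) y4 e6 e6'
    have lyy : g.l * y * y = 0 := g.nd4 (by norm_num : 3 < 5)
      (g.mul_mem (g.mul_mem g.l_mem hy) hy) hsp (by linear_combination l2yy) ly3
      (g.canc 3 (by norm_num) (by push_cast; linear_combination e5 - m * yyy))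
      (g.canc 3 (by norm_num) (by push_cast; linear_combination e5' - u * yyy))
    exact hn (g.nd4 (by norm_num : 3 < 5) (g.mul_mem (g.mem_pow 2) hy) hsp
      (by linear_combination h3) l2yy (by linear_combination e4 - m * lyy)
      (by linear_combination e4' - u * lyy))
  -- rank one case
  have hs2 : g.l ^ 2 * y * m * m ≠ 0 := by
    intro h
    apply hkm
    refine g.nd (by norm_num : 4 < 5) (g.mul_mem (g.mul_mem (g.mem_pow 2) hy) hmG) fun u hu => ?_
    obtain ⟨c, hc⟩ := hrk u hu
    linear_combination m * hc + algebraMap L A c * h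
  -- decomposition
  have hdec : ∀ u ∈ g.G 1, ∃ (c b : L) (D' : Derivation ℤ A A),
      D' g.l = u - algebraMap L A c * m ∧ D' y = algebraMap L A b * y ∧
      g.l ^ 2 * y * u = algebraMap L A c * (g.l ^ 2 * y * m) := by
    intro u hu
    obtain ⟨c, hc⟩ := hrk u hu
    have hn : u - algebraMap L A c * m ∈ g.G 1 := Submodule.sub_mem _ hu (g.C_mul_mem _ hmG)
    obtain ⟨D', hD', hDl'⟩ := g.exD hn
    obtain ⟨b, hb⟩ := hP D' _ hD' hDl' (by linear_combination hc)
    exact ⟨c, b, D', hDl', hb, hc⟩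
  have l2yy1 : g.l ^ 2 * y * y1 = 0 := by
    obtain ⟨τ, hτ⟩ := hrk y1 hy1
    by_cases hτ0 : τ = 0
    · rw [hτ, hτ0, map_zero, zero_mul]
    have f1 : g.l * y * y + algebraMap L A τ * (g.l ^ 2 * y) = 0 := by
      refine g.nd (by norm_num : 3 < 5) (Submodule.add_mem _
        (g.mul_mem (g.mul_mem g.l_mem hy) hy) (g.C_mul_mem _ (g.mul_mem (g.mem_pow 2) hy)))
        fun u hu => ?_
      obtain ⟨c, b, D', hDl', hb, hc⟩ := hdec u hu
      have := r4 D' _ hDl'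
      rw [hb] at this
      linear_combination this - algebraMap L A b * l2yy + algebraMap L A c * (e4 - hτ)
        + algebraMap L A τ * hc
    have f2 : y * y * y - 3 * (algebraMap L A τ * (algebraMap L A τ * (g.l ^ 2 * y))) = 0 := by
      have hmem : y * y * y - 3 * (algebraMap L A τ * (algebraMap L A τ * (g.l ^ 2 * y))) ∈ g.G 3 := by
        refine Submodule.sub_mem _ (g.mul_mem (g.mul_mem hy hy) hy) ?_
        have := g.C_mul_mem 3 (g.C_mul_mem τ (g.C_mul_mem τ (g.mul_mem (g.mem_pow 2) hy)))
        rwa [map_ofNat] at this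
      refine g.nd (by norm_num : 3 < 5) hmem fun u hu => ?_
      obtain ⟨c, b, D', hDl', hb, hc⟩ := hdec u hu
      have := r5 D' _ hDl'
      rw [hb] at this
      linear_combination this - 3 * algebraMap L A b * ly3
        + algebraMap L A c * (e5 - 3 * y1 * f1 + 3 * algebraMap L A τ * hτ)
        - 3 * algebraMap L A τ * algebraMap L A τ * hc
    have f3 : algebraMap L A τ * (algebraMap L A τ * (g.l ^ 2 * y * y1)) = 0 :=
      g.canc 3 (by norm_num) (by rw [Nat.cast_ofNat]; linear_combination e6 - y1 * f2)
    exact C_canc hτ0 (C_canc hτ0 f3)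
  have lyy : g.l * y * y = 0 := by
    refine g.nd (by norm_num : 3 < 5) (g.mul_mem (g.mul_mem g.l_mem hy) hy) fun u hu => ?_
    obtain ⟨c, b, D', hDl', hb, hc⟩ := hdec u hu
    have := r4 D' _ hDl'
    rw [hb] at this
    linear_combination this - algebraMap L A b * l2yy + algebraMap L A c * (e4 - l2yy1)
  have r7 : ∀ (D : Derivation ℤ A A) (u : A), D g.l = u → u * y * y + 2 * g.l * y * D y = 0 := by
    intro D u hDl
    have e2 := congrArg D lyy
    simp only [Derivation.leibniz, smul_eq_mul, map_zero, hDl] at e2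
    linear_combination e2
  have e7 := r7 D m hDl
  rw [hDy] at e7
  have hPy : ∀ u ∈ g.G 1, g.l ^ 2 * y * u = 0 → u * y * y = 0 := by
    intro u hu h
    obtain ⟨D', hD', hDl'⟩ := g.exD hu
    obtain ⟨b, hb⟩ := hP D' _ hD' hDl' h
    have := r7 D' _ hDl'
    rw [hb] at this
    linear_combination this - 2 * algebraMap L A b * lyy
  have y1yy : y1 * y * y = 0 := hPy _ hy1 l2yy1
  have yyy : y * y * y = 0 := hPy _ hy l2yy
  have hsp := g.span4 g.l_mem hy hy1 hmG (by
    intro α β γ δ e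
    have hδ : δ = 0 := C_zero_or hkm (by
      linear_combination g.l ^ 2 * y * e - algebraMap L A α * h3 - algebraMap L A β * l2yy
        - algebraMap L A γ * l2yy1)
    subst hδ
    rw [map_zero] at e
    have hα : α = 0 := C_zero_or g.l5
      (by linear_combination g.l ^ 4 * e - algebraMap L A β * g.l * h3
            - algebraMap L A γ * (g.l * e1 - 3 * m * h3))
    subst hα
    rw [map_zero] at e
    have hγ : γ = 0 := C_zero_or hkm (g.canc 3 (by norm_num) (by
      rw [Nat.cast_ofNat]
      linear_combination - g.l ^ 3 * e + algebraMap L A β * h3 + algebraMap L A γ * e1))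
    subst hγ
    rw [map_zero] at e
    exact ⟨rfl, C_zero_or hyne (by linear_combination e), rfl, rfl⟩)
  obtain ⟨α, β, γ, δ, hy2e⟩ := hsp y2 hy2
  have star : g.l ^ 3 * y2 + 6 * g.l ^ 2 * m * y1 + 6 * g.l * m * m * y = 0 := by
    have h := congrArg D (show g.l * g.l * m * y + g.l * g.l * m * y + g.l * g.l * m * y
      + g.l * g.l * g.l * y1 = 0 by linear_combination e1)
    simp only [Derivation.leibniz, smul_eq_mul, map_zero, map_add, hDl, hDm, hDy, hDy1] at h
    linear_combination h
  have star1 : - 3 * g.l ^ 2 * m * y * y2 + 6 * g.l ^ 2 * m * y1 * y1 + 6 * g.l * m * m * y * y1 = 0 := by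
    linear_combination y1 * star - y2 * e1
  have l2yy2 : g.l ^ 2 * y * y2 = algebraMap L A δ * (g.l ^ 2 * y * m) := by
    linear_combination g.l ^ 2 * y * hy2e + algebraMap L A α * h3 + algebraMap L A β * l2yy
        + algebraMap L A γ * l2yy1
  have yy : y * y = 0 := by
    by_contra hyy
    have mne : m * y * y ≠ 0 := fun h => hyy (g.nd4 (by norm_num : 2 < 5) (g.mul_mem hy hy) hsp
      (by linear_combination lyy) yyy (by linear_combination y1yy) (by linear_combination h))
    have lyy1 : g.l * y * y1 ≠ 0 := fun h => mne (by linear_combination e7 - 2 * h)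
    obtain ⟨a0, b0, c0, hne, hab⟩ := g.E2 (by
      intro z hz hz2
      obtain ⟨b, hb⟩ := hk z hz (by linear_combination g.l * hz2)
      have : b = 0 := C_zero_or hn (by linear_combination hz2 - g.l ^ 2 * hb)
      rw [hb, this, map_zero, zero_mul])
      (g.mul_mem hy hy) (g.mul_mem hy hy1) (g.mul_mem g.l_mem hy)
      (by linear_combination l2yy) (by linear_combination l2yy1) (by linear_combination h3)
    have hc0 : c0 ≠ 0 := by
      rintro rfl
      rw [map_zero] at hab
      have hb0 : b0 = 0 := C_zero_or lyy1 (by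
        linear_combination g.l * hab - algebraMap L A a0 * lyy)
      rw [hb0, map_zero] at hab
      have ha0 : a0 = 0 := C_zero_or hyy (by linear_combination hab)
      simp [ha0, hb0] at hne
    obtain ⟨f, G, hly⟩ : ∃ f G : L, g.l * y = algebraMap L A f * (y * y) + algebraMap L A G * (y * y1) := by
      refine ⟨-c0⁻¹ * a0, -c0⁻¹ * b0, ?_⟩
      have := inv_eq (C := algebraMap L A) hc0
      simp only [map_mul, map_neg]
      linear_combination (algebraMap L A c0⁻¹) * hab - (g.l * y) * this
    have hs : g.l ^ 2 * y * m = algebraMap L A G * (g.l * m * y * y1) := by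
      linear_combination g.l * m * hly + algebraMap L A f * m * lyy
    have k1 : y2 * y * y + 2 * y * y1 * y1 = 0 := by
      have h := congrArg D y1yy
      simp only [Derivation.leibniz, smul_eq_mul, map_zero, hDy, hDy1] at h
      linear_combination h
    have k2 : y * y1 * y1 = algebraMap L A δ * (g.l * y * y1) := by
      rw [← sub_eq_zero]
      refine g.canc 2 (by norm_num) ?_
      rw [Nat.cast_ofNat]
      linear_combination k1 - y * y * hy2e - algebraMap L A α * lyy - algebraMap L A β * yyy
        - algebraMap L A γ * y1yy - algebraMap L A δ * e7
    have k3 : G * δ - 1 = 0 := C_zero_or lyy1 (by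
      rw [map_sub, map_mul, map_one]
      linear_combination - y1 * hly - algebraMap L A f * y1yy - algebraMap L A G * k2)
    have k3' : algebraMap L A G * algebraMap L A δ = 1 := by
      rw [← map_mul, sub_eq_zero.1 k3, map_one]
    have k4 : 2 * g.l * m * y * y1 + g.l ^ 2 * y1 * y1 + g.l ^ 2 * y * y2 = 0 := by
      have h := congrArg D (show g.l * g.l * y * y1 = 0 by linear_combination l2yy1)
      simp only [Derivation.leibniz, smul_eq_mul, map_zero, hDl, hDy, hDy1] at h
      linear_combination h
    have k5 : g.l ^ 2 * y * y2 = g.l * m * y * y1 := by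
      linear_combination l2yy2 + algebraMap L A δ * hs + g.l * m * y * y1 * k3'
    have k6 : m * (g.l * m * y * y1) = 0 := g.canc 15 (by norm_num) (by
      rw [Nat.cast_ofNat]
      linear_combination - star1 - 9 * m * k5 + 6 * m * k4)
    exact hs2 (by linear_combination m * hs + algebraMap L A G * k6)
  have yy1 : y * y1 = 0 := by
    have h := congrArg D yy
    simp only [Derivation.leibniz, smul_eq_mul, map_zero, hDy] at h
    exact g.canc 2 (by norm_num) (by push_cast; linear_combination h)
  have y1y1 : y1 * y1 + y * y2 = 0 := by
    have h := congrArg D yy1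
    simp only [Derivation.leibniz, smul_eq_mul, map_zero, hDy, hDy1] at h
    linear_combination h
  have hδ : δ = 0 := C_zero_or hs2 (g.canc 9 (by norm_num) (by
    rw [Nat.cast_ofNat]
    linear_combination - star1 - 9 * m * l2yy2 + 6 * g.l ^ 2 * m * y1y1 + 6 * g.l * m * m * yy1))
  subst hδ
  rw [map_zero] at hy2e
  have hα : α ≠ 0 := by
    rintro rfl
    rw [map_zero] at hy2e
    refine hs2 (g.canc 12 (by norm_num) ?_)
    push_cast
    linear_combination - g.l * star + 6 * m * e1 + g.l ^ 4 * hy2e + algebraMap L A β * g.l * h3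
      + algebraMap L A γ * (g.l * e1 - 3 * m * h3)
  exact g.five (α := α) (β := β) (γ := γ) hD hDl hDm hDy (by rw [hDy1, hy2e]; ring) hα yy hsp

theorem kappa3 : ∀ y ∈ g.G 1, g.l ^ 3 * y = 0 → y = 0 := by
  apply g.stable
  by_contra! hcon
  obtain ⟨y, hy, h3, hn⟩ := hcon
  by_cases hA : ∀ z ∈ g.G 1, g.l ^ 3 * z = 0 → ∃ b : L, z = algebraMap L A b * y
  · exact g.caseA hy h3 hn hA
  push Not at hA
  obtain ⟨y', hy', h3', hn'⟩ := hA
  by_cases hB : ∀ z ∈ g.G 1, g.l ^ 3 * z = 0 → ∃ b c : L,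
      z = algebraMap L A b * y + algebraMap L A c * y'
  swap
  · push Not at hB
    obtain ⟨y'', hy'', h3'', hn''⟩ := hB
    exact g.caseC hy hy' hy'' h3 h3' h3'' hn hn' hn''
  by_cases h2 : ∀ y ∈ g.G 1, g.l ^ 2 * y = 0 → y = 0
  · exact g.caseB1 hy hy' h3 h3' hn hn' h2
  push Not at h2
  obtain ⟨z, hz, hz2, hzne⟩ := h2
  obtain ⟨b, c, hbc⟩ := hB z hz (by linear_combination g.l * hz2)
  have hc : c ≠ 0 := by
    rintro rfl
    rw [map_zero] at hbc
    have : b = 0 := C_zero_or hn (by linear_combination hz2 - g.l ^ 2 * hbc)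
    rw [this, map_zero] at hbc
    exact hzne (by rw [hbc]; ring)
  refine g.caseB2 hz hzne hz2 hn fun w hw hw3 => ?_
  obtain ⟨b', c', e⟩ := hB w hw hw3
  refine ⟨c' * c⁻¹, b' - c' * c⁻¹ * b, ?_⟩
  have := inv_eq (C := algebraMap L A) hc
  simp only [map_mul, map_sub]
  linear_combination e - algebraMap L A c' * algebraMap L A c⁻¹ * hbc - algebraMap L A c' * y' * this

end GA

set_option linter.unusedSectionVars false
namespace GA

variable {L A : Type*} [Field L] [CharZero L] [CommRing A] [Algebra L A] (g : GA L A)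

lemma fd2 : FiniteDimensional L (g.G 2) := Module.finite_of_finrank_pos (by rw [g.fr2]; norm_num)
lemma fd3 : FiniteDimensional L (g.G 3) := Module.finite_of_finrank_pos (by rw [g.fr3]; norm_num)
lemma fd5 : FiniteDimensional L (g.G 5) := Module.finite_of_finrank_pos (by rw [g.fr5]; norm_num)

/-- the part of `A_3` killed by the family `v` -/
def perp {k : ℕ} (v : Fin k → A) : Submodule L A :=
  g.G 3 ⊓ ⨅ i, LinearMap.ker (LinearMap.mulRight L (v i))

lemma mem_perp {k : ℕ} {v : Fin k → A} {s : A} :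
    s ∈ g.perp v ↔ s ∈ g.G 3 ∧ ∀ i, s * v i = 0 := by
  simp [perp, Submodule.mem_iInf]

lemma perp_le {k : ℕ} (v : Fin k → A) (hvG : ∀ i, v i ∈ g.G 2) (hv : LinearIndependent L v) :
    Module.finrank L (g.perp v) + k ≤ 6 := by
  have := g.fd2
  have := g.fd3
  have := g.fd5
  have fdp : FiniteDimensional L (g.perp v) :=
    Submodule.finiteDimensional_of_le (inf_le_left : g.perp v ≤ g.G 3)
  let φ : g.perp v →ₗ[L] (g.G 2 →ₗ[L] g.G 5) :=
    LinearMap.mk₂ L (fun u b => ⟨u.1 * b.1, g.mul_mem (g.mem_perp.1 u.2).1 b.2⟩)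
      (by intros; ext; simp; ring) (by intros; ext; simp)
      (by intros; ext; simp; ring) (by intros; ext; simp)
  have hφ : Function.Injective φ := by
    refine (injective_iff_map_eq_zero φ).2 fun u hu => ?_
    have hu3 := (g.mem_perp.1 u.2).1
    apply Subtype.ext
    refine g.nd (by norm_num : 3 < 5) hu3 fun v hv => ?_
    refine g.nd (by norm_num : 4 < 5) (g.mul_mem hu3 hv) fun w hw => ?_
    have := congrArg (fun f => ((f ⟨v * w, g.mul_mem hv hw⟩ : g.G 5) : A)) hu
    simp only [φ, LinearMap.mk₂_apply, LinearMap.zero_apply, Submodule.coe_zero] at this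
    linear_combination this
  let v' : Fin k → g.G 2 := fun i => ⟨v i, hvG i⟩
  have hv' : LinearIndependent L v' := LinearIndependent.of_comp (g.G 2).subtype hv
  let W := Submodule.span L (Set.range v')
  have hW : Module.finrank L W = k := by rw [finrank_span_eq_card hv']; simp
  have hker : ∀ u, W ≤ LinearMap.ker (φ u) := by
    intro u
    rw [Submodule.span_le]
    rintro _ ⟨i, rfl⟩
    rw [SetLike.mem_coe, LinearMap.mem_ker]
    ext
    simp [φ, v', (g.mem_perp.1 u.2).2 i]
  let ψ : g.perp v →ₗ[L] ((g.G 2 ⧸ W) →ₗ[L] g.G 5) :=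
    { toFun := fun u => W.liftQ (φ u) (hker u)
      map_add' := by intro u u'; ext z; simp
      map_smul' := by intro r u; ext z; simp }
  have hψ : Function.Injective ψ := by
    intro u u' h
    apply hφ
    ext z
    have := congrArg (fun f => ((f (W.mkQ z) : g.G 5) : A)) h
    simpa [ψ] using this
  have h3 := LinearMap.finrank_le_finrank_of_injective hψ
  rw [Module.finrank_linearMap, g.fr5] at h3
  have h4 := Submodule.finrank_quotient_add_finrank W
  rw [g.fr2, hW] at h4
  omega

lemma inj_le {l : A} (W P : Submodule L A) [FiniteDimensional L P] (h : ∀ w ∈ W, l * w ∈ P)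
    (h0 : ∀ w ∈ W, l * w = 0 → w = 0) : Module.finrank L W ≤ Module.finrank L P := by
  let φ : W →ₗ[L] P := (LinearMap.mulLeft L l).restrict h
  refine LinearMap.finrank_le_finrank_of_injective (f := φ) ?_
  refine (injective_iff_map_eq_zero φ).2 fun u hu => ?_
  have := congrArg (fun z : P => (z : A)) hu
  exact Subtype.ext (h0 u.1 u.2 this)

lemma iter_mem {D : Derivation ℤ A A} (hD : g.IsGD D) {a : A} {i : ℕ} (ha : a ∈ g.G i) (j : ℕ) :
    D^[j] a ∈ g.G i := by
  induction j with
  | zero => exact ha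
  | succ j ih => rw [Function.iterate_succ_apply']; exact hD.1 ih

lemma D_smul {D : Derivation ℤ A A} (hD : g.IsGD D) (c : L) (z : A) :
    ∃ c' : L, D (c • z) = c' • z + c • D z := by
  obtain ⟨c', hc'⟩ := hD.2 c
  refine ⟨c', ?_⟩
  rw [Algebra.smul_def, Derivation.leibniz, hc']
  simp only [smul_eq_mul, Algebra.smul_def]
  ring

lemma derSeq {D : Derivation ℤ A A} (hD : g.IsGD D) {a f : A} {k : ℕ}
    (h0 : ∀ j < k, f * D^[j] a = 0) (hk : f * D^[k] a ≠ 0) :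
    ∀ i, i ≤ k + 1 → LinearIndependent L (fun j : Fin i => D^[(j : ℕ)] a) := by
  intro i
  induction i with
  | zero => intro _; exact linearIndependent_empty_type
  | succ i ih =>
    intro hi
    rw [linearIndependent_finSucc']
    refine ⟨ih (by omega), fun hmem => hk ?_⟩
    set S := Submodule.span L (Set.range (Fin.init (fun j : Fin (i + 1) => D^[(j : ℕ)] a))) with hS
    simp only [Fin.val_last] at hmem
    have hgen : ∀ j, j ≤ i → D^[j] a ∈ S := by
      intro j hj
      rcases Nat.lt_or_ge j i with h | h
      · exact Submodule.subset_span ⟨⟨j, h⟩, rfl⟩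
      · rw [Nat.le_antisymm hj h]; exact hmem
    have hst : ∀ z ∈ S, D z ∈ S := by
      intro z hz
      rw [hS] at hz
      induction hz using Submodule.span_induction with
      | mem z hz =>
        obtain ⟨j, rfl⟩ := hz
        have := hgen (j + 1) (by omega)
        rw [Function.iterate_succ_apply'] at this
        exact this
      | zero => rw [map_zero]; exact S.zero_mem
      | add x y _ _ hx hy => rw [map_add]; exact S.add_mem hx hy
      | smul c x hx' hx =>
        obtain ⟨c', e⟩ := g.D_smul hD c x
        rw [e]
        exact S.add_mem (S.smul_mem _ hx') (S.smul_mem _ hx)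
    have hall : ∀ j, D^[j] a ∈ S := by
      intro j
      induction j with
      | zero => exact hgen 0 (by omega)
      | succ j ih => rw [Function.iterate_succ_apply']; exact hst _ ih
    have hle : S ≤ LinearMap.ker (LinearMap.mulLeft L f) := by
      rw [hS, Submodule.span_le]
      rintro _ ⟨j, rfl⟩
      rw [SetLike.mem_coe, LinearMap.mem_ker, LinearMap.mulLeft_apply]
      exact h0 j (by omega)
    have := hle (hall k)
    rwa [LinearMap.mem_ker, LinearMap.mulLeft_apply] at this

/-- The filtration on linear forms. -/
def Fl (D : Derivation ℤ A A) (a : A) : ℕ → A → Prop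
  | 0, n => n ∈ g.G 1
  | i + 1, n => n ∈ g.G 1 ∧ n * a = 0 ∧ Fl D a i (D n)

lemma Fl_zero {D : Derivation ℤ A A} {a n : A} {i : ℕ} (h : g.Fl D a i n) : n ∈ g.G 1 := by
  cases i with
  | zero => exact h
  | succ i => exact h.1

lemma Fl_D {D : Derivation ℤ A A} (hD : g.IsGD D) {a n : A} {i : ℕ} (h : g.Fl D a i n) :
    g.Fl D a (i - 1) (D n) := by
  cases i with
  | zero => exact hD.1 h
  | succ i => exact h.2.2

lemma tstep {D : Derivation ℤ A A} {a u v w : A} {j : ℕ} (h : D^[j] a * u * v * w = 0) :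
    D^[j + 1] a * u * v * w = -(D^[j] a * D u * v * w + D^[j] a * u * D v * w
      + D^[j] a * u * v * D w) := by
  have e := congrArg D h
  rw [Function.iterate_succ_apply']
  simp only [Derivation.leibniz, smul_eq_mul, map_zero] at e
  linear_combination e

lemma claim {D : Derivation ℤ A A} (hD : g.IsGD D) {a : A} (j : ℕ) :
    ∀ {i k p : ℕ} {u v w : A}, g.Fl D a i u → g.Fl D a k v → g.Fl D a p w → j < i + k + p →
      D^[j] a * u * v * w = 0 := by
  induction j with
  | zero =>
    intro i k p u v w hu hv hw h
    simp only [Function.iterate_zero, id]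
    cases i with
    | succ i => linear_combination v * w * hu.2.1
    | zero =>
      cases k with
      | succ k => linear_combination u * w * hv.2.1
      | zero =>
        cases p with
        | succ p => linear_combination u * v * hw.2.1
        | zero => omega
  | succ j ih =>
    intro i k p u v w hu hv hw h
    rw [tstep (ih hu hv hw (by omega)), ih (g.Fl_D hD hu) hv hw (by omega),
      ih hu (g.Fl_D hD hv) hw (by omega), ih hu hv (g.Fl_D hD hw) (by omega)]
    ring

/-- no long string: the non-line case -/
lemma nonline {D : Derivation ℤ A A} (hD : g.IsGD D) {a n : A} (ha : a ∈ g.G 2)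
    (hn : g.Fl D a 2 n) (hX : a * D (D n) * D (D n) * D (D n) ≠ 0) : False := by
  obtain ⟨n1, h1⟩ : ∃ n1, D n = n1 := ⟨_, rfl⟩
  obtain ⟨n2, h2⟩ : ∃ n2, D n1 = n2 := ⟨_, rfl⟩
  have F1 : g.Fl D a 1 n1 := h1 ▸ g.Fl_D hD hn
  have F2 : g.Fl D a 0 n2 := h2 ▸ g.Fl_D hD F1
  have F3 : g.Fl D a 0 (D n2) := hD.1 F2
  rw [h1, h2] at hX
  have c := @claim L A _ _ _ _ g D hD a
  have t1 : D^[1] a * n2 * n2 * n1 = -(a * n2 * n2 * n2) := by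
    rw [tstep (c 0 F2 F2 F1 (by omega)), c 0 F3 F2 F1 (by omega), c 0 F2 F3 F1 (by omega), h2]
    simp
  have t1' : D^[1] a * n2 * n1 * n2 = -(a * n2 * n2 * n2) := by linear_combination t1
  have t2 : D^[2] a * n2 * n2 * n = a * n2 * n2 * n2 := by
    rw [tstep (c 1 F2 F2 hn (by omega)), c 1 F3 F2 hn (by omega), c 1 F2 F3 hn (by omega), h1]
    linear_combination -t1
  have t2' : D^[2] a * n2 * n1 * n1 = 2 * (a * n2 * n2 * n2) := by
    rw [tstep (c 1 F2 F1 F1 (by omega)), c 1 F3 F1 F1 (by omega), h2]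
    linear_combination -2 * t1
  have t3 : D^[3] a * n2 * n1 * n = -3 * (a * n2 * n2 * n2) := by
    rw [tstep (c 2 F2 F1 hn (by omega)), c 2 F3 F1 hn (by omega), h2, h1]
    linear_combination -t2 - t2'
  have t3' : D^[3] a * n1 * n1 * n1 = -6 * (a * n2 * n2 * n2) := by
    rw [tstep (c 2 F1 F1 F1 (by omega)), h2]
    linear_combination -3 * t2'
  have t4 : D^[4] a * n2 * n * n = 6 * (a * n2 * n2 * n2) := by
    rw [tstep (c 3 F2 hn hn (by omega)), c 3 F3 hn hn (by omega), h1]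
    linear_combination -2 * t3
  have t4' : D^[4] a * n1 * n1 * n = 12 * (a * n2 * n2 * n2) := by
    rw [tstep (c 3 F1 F1 hn (by omega)), h2, h1]
    linear_combination -2 * t3 - t3'
  have t5 : D^[5] a * n1 * n * n = -30 * (a * n2 * n2 * n2) := by
    rw [tstep (c 4 F1 hn hn (by omega)), h2, h1]
    linear_combination -t4 - 2 * t4'
  have t6 : D^[6] a * n * n * n = 90 * (a * n2 * n2 * n2) := by
    rw [tstep (c 5 hn hn hn (by omega)), h1]
    linear_combination -3 * t5
  have li := g.derSeq hD (a := a) (f := n * n * n) (k := 6)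
    (fun j hj => by linear_combination c j hn hn hn (by omega))
    (fun h => hX (g.canc 90 (by norm_num) (by push_cast; linear_combination h - t6))) 7 (by omega)
  have := g.fd2
  have hle : Submodule.span L (Set.range (fun j : Fin 7 => D^[(j : ℕ)] a)) ≤ g.G 2 := by
    rw [Submodule.span_le]
    rintro _ ⟨j, rfl⟩
    exact g.iter_mem hD ha j
  have h := Submodule.finrank_mono hle
  rw [finrank_span_eq_card li, g.fr2] at h
  simp at h

theorem wlp : ∀ a ∈ g.G 2, g.l * a = 0 → a = 0 := by
  intro a ha hla
  by_contra hane
  have k2 : ∀ y ∈ g.G 1, g.l ^ 2 * y = 0 → y = 0 := fun y hy h =>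
    g.kappa3 y hy (by linear_combination g.l * h)
  obtain ⟨k, hkm⟩ := g.ex_x (by norm_num : 2 < 5) ha hane
  obtain ⟨m, hm⟩ : ∃ m, m = g.x k := ⟨_, rfl⟩
  have hmG : m ∈ g.G 1 := hm ▸ g.x_mem k
  obtain ⟨D, hDe⟩ : ∃ D, D = g.d k := ⟨_, rfl⟩
  have hD : g.IsGD D := hDe ▸ g.isGD_d k
  have hDl : D g.l = m := by rw [hDe, hm, g.d_l]
  have hDm : D m = 0 := by rw [hDe, hm, g.d_x]
  rw [← hm] at hkm
  have e1 : m * a + g.l * D a = 0 := by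
    have h := congrArg D hla
    simp only [Derivation.leibniz, smul_eq_mul, map_zero, hDl] at h
    linear_combination h
  have l2a1 : g.l ^ 2 * D a = 0 := by linear_combination g.l * e1 - m * hla
  have l1a1 : g.l * D a ≠ 0 := fun h => hkm (by linear_combination e1 - h)
  have hE : ∀ w ∈ g.G 2, g.l ^ 2 * w = 0 → ∃ β γ : L,
      w = algebraMap L A β * a + algebraMap L A γ * D a := by
    intro w hw hw2
    obtain ⟨β, γ, δ, hne, e⟩ := g.E2 k2 ha (hD.1 ha) hw
      (by linear_combination g.l * hla) l2a1 hw2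
    have hδ : δ ≠ 0 := by
      rintro rfl
      rw [map_zero] at e
      have hγ : γ = 0 := C_zero_or l1a1 (by linear_combination g.l * e - algebraMap L A β * hla)
      rw [hγ, map_zero] at e
      have hβ : β = 0 := C_zero_or hane (by linear_combination e)
      simp [hγ, hβ] at hne
    refine ⟨-δ⁻¹ * β, -δ⁻¹ * γ, ?_⟩
    have := inv_eq (C := algebraMap L A) hδ
    simp only [map_mul, map_neg]
    linear_combination (algebraMap L A δ⁻¹) * e - w * this
  have hK : ∀ w ∈ g.G 2, g.l * w = 0 → ∃ β : L, w = algebraMap L A β * a := by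
    intro w hw hw1
    obtain ⟨β, γ, e⟩ := hE w hw (by linear_combination g.l * hw1)
    have : γ = 0 := C_zero_or l1a1 (by linear_combination hw1 - g.l * e - algebraMap L A β * hla)
    refine ⟨β, ?_⟩
    rw [e, this, map_zero]; ring
  have rk : ∀ u ∈ g.G 1, ∃ c : L, u * a = algebraMap L A c * (m * a) := by
    intro u hu
    obtain ⟨D', hD', hDl'⟩ := g.exD hu
    have h := congrArg D' hla
    simp only [Derivation.leibniz, smul_eq_mul, map_zero, hDl'] at h
    obtain ⟨β, γ, e⟩ := hE (D' a) (hD'.1 ha) (by linear_combination g.l * h - u * hla)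
    refine ⟨γ, ?_⟩
    linear_combination h - g.l * e - algebraMap L A β * hla - algebraMap L A γ * e1
  have m2a : a * m * m ≠ 0 := by
    intro h
    refine hkm (g.nd (by norm_num : 3 < 5) (g.mul_mem ha hmG) fun u hu => ?_)
    obtain ⟨c, hc⟩ := rk u hu
    linear_combination m * hc + algebraMap L A c * h
  have m3a : a * m * m * m ≠ 0 := by
    intro h
    refine m2a (g.nd (by norm_num : 4 < 5) (g.mul_mem (g.mul_mem ha hmG) hmG) fun u hu => ?_)
    obtain ⟨c, hc⟩ := rk u hu
    linear_combination m * m * hc + algebraMap L A c * h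
  have hline : ∀ n, g.Fl D a 2 n → D (D n) * a = 0 := by
    intro n hn
    by_contra h
    have hn2 : D (D n) ∈ g.G 1 := hn.2.2.2.2
    obtain ⟨c, hc⟩ := rk _ hn2
    refine g.nonline hD ha hn ?_
    have hc0 : c ≠ 0 := by rintro rfl; apply h; rw [hc, map_zero, zero_mul]
    intro h0
    apply m3a
    refine C_canc hc0 (C_canc hc0 (C_canc hc0 (?_ : algebraMap L A c * (algebraMap L A c *
      (algebraMap L A c * (a * m * m * m))) = 0)))
    linear_combination h0 - D (D n) * D (D n) * hc - algebraMap L A c * m * D (D n) * hc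
      - algebraMap L A c * algebraMap L A c * m * m * hc
  have hFD : ∀ n, g.Fl D a 2 n → g.Fl D a 2 (D n) := fun n hn =>
    ⟨hn.2.2.1, hn.2.2.2.1, hn.2.2.2.2, hline n hn, hD.1 hn.2.2.2.2⟩
  have hNV : ∀ j n, g.Fl D a 2 n → n * D^[j] a = 0 := by
    intro j
    induction j with
    | zero => intro n hn; exact hn.2.1
    | succ j ih =>
      intro n hn
      have h := congrArg D (ih n hn)
      simp only [Derivation.leibniz, smul_eq_mul, map_zero] at h
      rw [Function.iterate_succ_apply']
      linear_combination h - ih _ (hFD n hn)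
  have hdec : ∀ u ∈ g.G 1, ∃ (n : A) (e c : L), g.Fl D a 2 n ∧
      u = n + algebraMap L A e * g.l + algebraMap L A c * m := by
    intro u hu
    obtain ⟨c, hc⟩ := rk u hu
    obtain ⟨e, he⟩ := rk (D (u - algebraMap L A c * m))
      (hD.1 (Submodule.sub_mem _ hu (g.C_mul_mem _ hmG)))
    refine ⟨u - algebraMap L A c * m - algebraMap L A e * g.l, e, c, ?_, by ring⟩
    have hG : u - algebraMap L A c * m - algebraMap L A e * g.l ∈ g.G 1 :=
      Submodule.sub_mem _ (Submodule.sub_mem _ hu (g.C_mul_mem _ hmG)) (g.C_mul_mem _ g.l_mem)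
    refine ⟨hG, ?_, hD.1 hG, ?_, hD.1 (hD.1 hG)⟩
    · linear_combination hc - algebraMap L A e * hla
    · obtain ⟨e', he'⟩ := hD.2 e
      have : D (u - algebraMap L A c * m - algebraMap L A e * g.l)
          = D (u - algebraMap L A c * m) - (algebraMap L A e * m + g.l * algebraMap L A e') := by
        rw [map_sub, Derivation.leibniz, hDl, he', smul_eq_mul, smul_eq_mul]
      rw [this]
      linear_combination he - algebraMap L A e' * hla
  -- independence of a_0..a_3
  have Fl1 : g.Fl D a 1 g.l := ⟨g.l_mem, hla, hD.1 g.l_mem⟩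
  have Fm : g.Fl D a 0 m := hmG
  have c := @claim L A _ _ _ _ g D hD a
  have t1 : D^[1] a * g.l * m * m = -(a * m * m * m) := by
    rw [tstep (c 0 Fl1 Fm Fm (by omega)), hDl, hDm]; simp
  have t2 : D^[2] a * g.l * g.l * m = 2 * (a * m * m * m) := by
    rw [tstep (c 1 Fl1 Fl1 Fm (by omega)), hDl, hDm]
    linear_combination -2 * t1
  have t3 : D^[3] a * g.l * g.l * g.l = -6 * (a * m * m * m) := by
    rw [tstep (c 2 Fl1 Fl1 Fl1 (by omega)), hDl]
    linear_combination -3 * t2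
  have li : LinearIndependent L (fun j : Fin 4 => D^[(j : ℕ)] a) :=
    g.derSeq hD (a := a) (f := g.l * g.l * g.l) (k := 3)
    (fun j hj => by linear_combination c j Fl1 Fl1 Fl1 (by omega))
    (fun h => m3a (g.canc 6 (by norm_num) (by push_cast; linear_combination - h + t3))) 4 (by omega)
  set v : Fin 4 → A := fun j : Fin 4 => D^[(j : ℕ)] a with hv
  have hperp := g.perp_le v (fun i => g.iter_mem hD ha i) li
  have := g.fd2
  have := g.fd3
  have fdp : FiniteDimensional L (g.perp v) :=
    Submodule.finiteDimensional_of_le (inf_le_left : g.perp v ≤ g.G 3)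
  -- M_2
  let M : Submodule L A := Submodule.span L {z | ∃ n u, g.Fl D a 2 n ∧ u ∈ g.G 1 ∧ z = n * u}
  have hMmem : ∀ {n u : A}, g.Fl D a 2 n → u ∈ g.G 1 → n * u ∈ M := fun hn hu =>
    Submodule.subset_span ⟨_, _, hn, hu, rfl⟩
  have hMG : M ≤ g.G 2 := by
    refine Submodule.span_le.2 ?_
    rintro _ ⟨n, u, hn, hu, rfl⟩
    exact g.mul_mem hn.1 hu
  have fdM : FiniteDimensional L M := Submodule.finiteDimensional_of_le hMG
  have hMV : ∀ z ∈ M, ∀ j, z * D^[j] a = 0 := by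
    intro z hz j
    have : M ≤ LinearMap.ker (LinearMap.mulRight L (D^[j] a)) := by
      refine Submodule.span_le.2 ?_
      rintro _ ⟨n, u, hn, hu, rfl⟩
      rw [SetLike.mem_coe, LinearMap.mem_ker, LinearMap.mulRight_apply]
      linear_combination u * hNV j n hn
    have := this hz
    rwa [LinearMap.mem_ker, LinearMap.mulRight_apply] at this
  have hMD : ∀ z ∈ M, D z ∈ M := by
    intro z hz
    induction hz using Submodule.span_induction with
    | mem z hz =>
      obtain ⟨n, u, hn, hu, rfl⟩ := hz
      rw [Derivation.leibniz, smul_eq_mul, smul_eq_mul, mul_comm u]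
      exact M.add_mem (hMmem hn (hD.1 hu)) (hMmem (hFD n hn) hu)
    | zero => rw [map_zero]; exact M.zero_mem
    | add x y _ _ hx hy => rw [map_add]; exact M.add_mem hx hy
    | smul c x hx' hx =>
      obtain ⟨c', e⟩ := g.D_smul hD c x
      rw [e]
      exact M.add_mem (M.smul_mem _ hx') (M.smul_mem _ hx)
  have hM3 : 3 ≤ Module.finrank L M := by
    let s : Fin 3 → A := ![g.l * g.l, g.l * m, m * m]
    have hfs : Module.Finite L (Submodule.span L (Set.range s)) :=
      .span_of_finite L (Set.finite_range s)
    have hle : g.G 2 ≤ M ⊔ Submodule.span L (Set.range s) := by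
      apply g.G2
      intro u hu w hw
      obtain ⟨n, e, c, hn, hu'⟩ := hdec u hu
      obtain ⟨n', e', c', hn', hw'⟩ := hdec w hw
      have hS : ∀ i, s i ∈ Submodule.span L (Set.range s) := fun i => Submodule.subset_span ⟨i, rfl⟩
      have h1 : n * w + n' * (algebraMap L A e * g.l + algebraMap L A c * m) ∈ M :=
        M.add_mem (hMmem hn hw) (hMmem hn' (Submodule.add_mem _ (g.C_mul_mem _ g.l_mem)
          (g.C_mul_mem _ hmG)))
      have h2 := Submodule.add_mem _ (Submodule.add_mem _ (Submodule.smul_mem _ (e * e') (hS 0))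
        (Submodule.smul_mem _ (e * c' + c * e') (hS 1))) (Submodule.smul_mem _ (c * c') (hS 2))
      have h3 := Submodule.add_mem_sup h1 h2
      convert h3 using 1
      simp only [s, Matrix.cons_val, Algebra.smul_def, map_add, map_mul]
      rw [hu', hw']
      ring
    have h1 := Submodule.finrank_mono hle
    have h2 := Submodule.finrank_add_le_finrank_add_finrank M (Submodule.span L (Set.range s))
    have h3 := finrank_range_le_card (R := L) s
    unfold Set.finrank at h3
    simp at h3
    rw [g.fr2] at h1
    omega
  have haM : a ∈ M := by
    by_contra haM
    have := inj_le (l := g.l) M (g.perp v) (fun w hw => g.mem_perp.2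
      ⟨(g.mul_mem g.l_mem (hMG hw) : _ ∈ g.G (1 + 2)), fun i => by
        rw [mul_assoc, hv, hMV w hw, mul_zero]⟩) (by
      intro w hw hlw
      obtain ⟨β, hβ⟩ := hK w (hMG hw) hlw
      by_cases hβ0 : β = 0
      · rw [hβ, hβ0, map_zero, zero_mul]
      · exfalso
        apply haM
        have h := M.smul_mem β⁻¹ hw
        convert h using 1
        rw [Algebra.smul_def, hβ]
        linear_combination -a * inv_eq (C := algebraMap L A) hβ0)
    omega
  have hVM : ∀ j, D^[j] a ∈ M := by
    intro j
    induction j with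
    | zero => exact haM
    | succ j ih => rw [Function.iterate_succ_apply']; exact hMD _ ih
  -- last contradiction
  have li3 : LinearIndependent L (fun j : Fin 3 => v j.succ) :=
    li.comp Fin.succ (Fin.succ_injective _)
  have hfr := finrank_span_eq_card li3
  rw [Fintype.card_fin] at hfr
  have hWM : Submodule.span L (Set.range (fun j : Fin 3 => v j.succ)) ≤ M := by
    refine Submodule.span_le.2 ?_
    rintro _ ⟨j, rfl⟩
    exact hVM _
  have := inj_le (l := g.l) _ (g.perp v) (fun w hw => g.mem_perp.2
      ⟨(g.mul_mem g.l_mem (hMG (hWM hw)) : _ ∈ g.G (1 + 2)), fun i => by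
        rw [mul_assoc, hv, hMV w (hWM hw), mul_zero]⟩) (by
      intro w hw hlw
      obtain ⟨β, hβ⟩ := hK w (hMG (hWM hw)) hlw
      rw [Submodule.mem_span_range_iff_exists_fun] at hw
      obtain ⟨f, hf⟩ := hw
      rw [Fin.sum_univ_three] at hf
      rw [Fintype.linearIndependent_iff] at li
      have := li ![-β, f 0, f 1, f 2] (by
        simp only [Fin.sum_univ_four, Matrix.cons_val]
        have h0 : v 0 = a := rfl
        have e1 : v 1 = v (Fin.succ 0) := rfl
        have e2 : v 2 = v (Fin.succ 1) := rfl
        have e3 : v 3 = v (Fin.succ 2) := rfl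
        rw [e1, e2, e3, h0, neg_smul, Algebra.smul_def β, ← hβ, ← hf]
        abel) 0
      simp at this
      rw [hβ, this, map_zero, zero_mul])
  omega

end GA

open MvPolynomial

section PieceLemmas

variable {K : Type*} [Field K] {n : ℕ} {I : Ideal (MvPolynomial (Fin n) K)}

lemma mem_piece_iff {i : ℕ} {b : MvPolynomial (Fin n) K ⧸ I} :
    b ∈ piece I i ↔ ∃ p : MvPolynomial (Fin n) K, p.IsHomogeneous i ∧ Ideal.Quotient.mk I p = b := by
  unfold piece
  simp [Submodule.mem_map, mem_homogeneousSubmodule]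

lemma mk_mem_piece {i : ℕ} {p : MvPolynomial (Fin n) K} (hp : p.IsHomogeneous i) :
    Ideal.Quotient.mk I p ∈ piece I i := mem_piece_iff.2 ⟨p, hp, rfl⟩

lemma piece_mul_mem {i j : ℕ} {a b : MvPolynomial (Fin n) K ⧸ I} (ha : a ∈ piece I i)
    (hb : b ∈ piece I j) : a * b ∈ piece I (i + j) := by
  obtain ⟨p, hp, rfl⟩ := mem_piece_iff.1 ha
  obtain ⟨q, hq, rfl⟩ := mem_piece_iff.1 hb
  rw [← map_mul]
  exact mk_mem_piece (hp.mul hq)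

lemma piece_succ_le {i : ℕ} (T : Submodule K (MvPolynomial (Fin n) K ⧸ I))
    (h : ∀ j, ∀ q ∈ piece I i, Ideal.Quotient.mk I (X j) * q ∈ T) : piece I (i + 1) ≤ T := by
  intro b hb
  obtain ⟨p, hp, rfl⟩ := mem_piece_iff.1 hb
  rw [p.as_sum, map_sum]
  refine Submodule.sum_mem _ fun m hm => ?_
  have hdeg : m.degree = i + 1 := by
    have := hp (mem_support_iff.1 hm)
    rw [← this, Finsupp.degree_eq_weight_one]; rfl
  have : ∃ j, m j ≠ 0 := by
    by_contra! hcon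
    have : m = 0 := by ext j; simpa using hcon j
    subst this
    simp at hdeg
  obtain ⟨j, hj⟩ := this
  have hle : Finsupp.single j 1 ≤ m := by
    rw [Finsupp.single_le_iff]; omega
  have hm' : Finsupp.single j 1 + (m - Finsupp.single j 1) = m := add_tsub_cancel_of_le hle
  have e : monomial m (coeff m p) = X j * monomial (m - Finsupp.single j 1) (coeff m p) := by
    rw [X, monomial_mul, one_mul, hm']
  rw [e, map_mul]
  refine h j _ (mk_mem_piece ?_)
  apply isHomogeneous_monomial
  have := congrArg Finsupp.degree hm'
  rw [map_add, Finsupp.degree_single, hdeg] at this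
  omega

lemma piece_zero_le : piece I 0 ≤ Submodule.span K {1} := by
  intro b hb
  obtain ⟨p, hp, rfl⟩ := mem_piece_iff.1 hb
  rw [← mem_homogeneousSubmodule, homogeneousSubmodule_zero] at hp
  obtain ⟨c, rfl⟩ := Submodule.mem_one.1 hp
  rw [Submodule.mem_span_singleton]
  refine ⟨c, ?_⟩
  rw [Algebra.algebraMap_eq_smul_one]
  rfl

lemma one_mem_piece : (1 : MvPolynomial (Fin n) K ⧸ I) ∈ piece I 0 := by
  rw [← map_one (Ideal.Quotient.mk I)]
  exact mk_mem_piece (isHomogeneous_one _ _)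

instance piece_finite (i : ℕ) : FiniteDimensional K (piece I i) := by
  induction i with
  | zero =>
    exact Submodule.finiteDimensional_of_le (piece_zero_le (I := I))
  | succ i ih =>
    have : piece I (i + 1) ≤ ⨆ j : Fin n, (piece I i).map
        (LinearMap.mulLeft K (Ideal.Quotient.mk I (X j))) := by
      apply piece_succ_le
      intro j q hq
      refine Submodule.mem_iSup_of_mem j ?_
      exact ⟨q, hq, rfl⟩
    exact Submodule.finiteDimensional_of_le this

lemma piece_inter (hI : IsHomogIdeal I) {i j : ℕ} (hij : i ≠ j)
    {b : MvPolynomial (Fin n) K ⧸ I} (hi : b ∈ piece I i) (hj : b ∈ piece I j) : b = 0 := by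
  obtain ⟨p, hp, rfl⟩ := mem_piece_iff.1 hi
  obtain ⟨q, hq, hqp⟩ := mem_piece_iff.1 hj
  rw [Ideal.Quotient.eq] at hqp
  have := hI _ hqp i
  rw [map_sub, homogeneousComponent_of_mem hq, homogeneousComponent_of_mem hp] at this
  rw [if_neg hij, if_pos rfl, zero_sub, neg_mem_iff] at this
  exact Ideal.Quotient.eq_zero_iff_mem.2 this

lemma X_mem_piece (j : Fin n) : Ideal.Quotient.mk I (X j) ∈ piece I 1 :=
  mk_mem_piece (isHomogeneous_X _ _)

lemma exists_red (hI : IsHomogIdeal I) {d : ℕ} (hs : socle I ≤ piece I d) {i : ℕ} (hi : i ≠ d) :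
    ∃ r : Fin n → ((MvPolynomial (Fin n) K ⧸ I) →ₗ[K] (MvPolynomial (Fin n) K ⧸ I)),
      ∀ p ∈ piece I i, p = ∑ j, r j (Ideal.Quotient.mk I (X j) * p) := by
  let Φ : piece I i →ₗ[K] (Fin n → (MvPolynomial (Fin n) K ⧸ I)) :=
    LinearMap.pi fun j => (LinearMap.mulLeft K (Ideal.Quotient.mk I (X j))).comp (piece I i).subtype
  have hΦ : LinearMap.ker Φ = ⊥ := by
    rw [LinearMap.ker_eq_bot']
    rintro ⟨p, hp⟩ h
    have : p ∈ socle I := by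
      unfold socle
      rw [Submodule.mem_iInf]
      intro j
      exact congrFun h j
    exact Subtype.ext (piece_inter hI hi hp (hs this))
  obtain ⟨r, hr⟩ := LinearMap.exists_leftInverse_of_injective Φ hΦ
  refine ⟨fun j => (piece I i).subtype ∘ₗ r ∘ₗ
    LinearMap.single K (fun _ : Fin n => (MvPolynomial (Fin n) K ⧸ I)) j, fun p hp => ?_⟩
  have h := LinearMap.congr_fun hr ⟨p, hp⟩
  have h2 : Φ ⟨p, hp⟩ = ∑ j, LinearMap.single K (fun _ : Fin n => (MvPolynomial (Fin n) K ⧸ I)) j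
      (Ideal.Quotient.mk I (X j) * p) := by
    simp only [LinearMap.coe_single]
    rw [Finset.univ_sum_single]
    rfl
  rw [LinearMap.comp_apply, h2, map_sum] at h
  have := congrArg (piece I i).subtype h
  rw [map_sum] at this
  exact this.symm

end PieceLemmas

section Der

variable (K : Type*) [Field K] (n : ℕ)

/-- Partial derivative on the field of rational functions. -/
lemma exists_der (k : Fin n) : ∃ δ : FractionRing (MvPolynomial (Fin n) K) →ₗ[K]
      FractionRing (MvPolynomial (Fin n) K),
    (∀ a b, δ (a * b) = a * δ b + b * δ a) ∧
    ∀ j, δ (algebraMap (MvPolynomial (Fin n) K) _ (X j)) = if k = j then 1 else 0 := by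
  set S := MvPolynomial (Fin n) K
  set L := FractionRing S
  let f : S →ₐ[K] TrivSqZeroExt L L :=
    aeval (fun j => TrivSqZeroExt.inl (algebraMap S L (X j)) +
      TrivSqZeroExt.inr (if k = j then (1 : L) else 0))
  have hf : (TrivSqZeroExt.fstHom K L L).comp f = (Algebra.ofId S L).restrictScalars K := by
    apply MvPolynomial.algHom_ext
    intro j
    simp [f]
    rfl
  have hf' : ∀ s, (f s).fst = algebraMap S L s := fun s => AlgHom.congr_fun hf s
  have hu : ∀ y : nonZeroDivisors S, IsUnit (f y) := by
    intro y
    rw [TrivSqZeroExt.isUnit_iff_isUnit_fst, hf']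
    exact IsLocalization.map_units L y
  let F : L →ₐ[K] TrivSqZeroExt L L := IsLocalization.liftAlgHom (M := nonZeroDivisors S) (f := f) hu
  have hF : ∀ s, F (algebraMap S L s) = f s := fun s => IsLocalization.lift_eq _ s
  have hid : ∀ a, (F a).fst = a := by
    have : ((TrivSqZeroExt.fstHom K L L).comp F).toRingHom = RingHom.id L := by
      apply IsLocalization.ringHom_ext (nonZeroDivisors S)
      ext s
      · simp [hF, hf']
      · simp [hF, hf']
    intro a
    exact RingHom.congr_fun this a
  refine ⟨(TrivSqZeroExt.sndHom L L).restrictScalars K ∘ₗ F.toLinearMap, ?_, ?_⟩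
  · intro a b
    simp [hid, mul_comm]
  · intro j
    change (F (algebraMap S L (X j))).snd = _
    rw [hF]
    have : f (X j) = _ := aeval_X _ j
    rw [this]
    simp

end Der

open MvPolynomial
open scoped TensorProduct

section Transfer

variable {K L B : Type*} [Field K] [Field L] [Algebra K L] [CommRing B] [Algebra K B]

/-- A derivation from an additive map with the Leibniz rule. -/
def mkDer {A : Type*} [CommRing A] (f : A →+ A) (h : ∀ a b, f (a * b) = a * f b + b * f a) :
    Derivation ℤ A A :=
  Derivation.mk' f.toIntLinearMap h

lemma mkDer_apply {A : Type*} [CommRing A] (f : A →+ A)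
    (h : ∀ a b, f (a * b) = a * f b + b * f a) (a : A) : mkDer f h a = f a := rfl

lemma rT_leib (δ : L →ₗ[K] L) (hδ : ∀ a b, δ (a * b) = a * δ b + b * δ a) (a b : L ⊗[K] B) :
    (LinearMap.rTensor B δ).toAddMonoidHom (a * b) =
      a * (LinearMap.rTensor B δ).toAddMonoidHom b +
        b * (LinearMap.rTensor B δ).toAddMonoidHom a := by
  change LinearMap.rTensor B δ (a * b) =
      a * LinearMap.rTensor B δ b + b * LinearMap.rTensor B δ a
  induction a using TensorProduct.induction_on with
  | zero => simp
  | add a a' h h' => rw [add_mul, map_add, h, h', map_add]; ring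
  | tmul c x =>
    induction b using TensorProduct.induction_on with
    | zero => simp
    | add a a' h h' => rw [mul_add, map_add, h, h', map_add]; ring
    | tmul c' x' =>
      simp only [Algebra.TensorProduct.tmul_mul_tmul, LinearMap.rTensor_tmul, hδ,
        TensorProduct.add_tmul]
      rw [mul_comm x' x]

lemma mem_bc_induction {p : Submodule K B} {P : L ⊗[K] B → Prop}
    (h0 : P 0) (hadd : ∀ a b, P a → P b → P (a + b)) (ht : ∀ (c : L), ∀ b ∈ p, P (c ⊗ₜ b))
    {a : L ⊗[K] B} (ha : a ∈ p.baseChange L) : P a := by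
  obtain ⟨w, rfl⟩ := ha
  induction w using TensorProduct.induction_on with
  | zero => simpa using h0
  | add a b ha hb => rw [map_add]; exact hadd _ _ ha hb
  | tmul c b => exact ht c b b.2

lemma bc_le {p : Submodule K B} {T : Submodule L (L ⊗[K] B)}
    (ht : ∀ b ∈ p, (1 : L) ⊗ₜ[K] b ∈ T) : p.baseChange L ≤ T := by
  intro a ha
  refine mem_bc_induction (P := fun a => a ∈ T) T.zero_mem (fun a b => T.add_mem) ?_ ha
  intro c b hb
  have := T.smul_mem c (ht b hb)
  rwa [TensorProduct.smul_tmul', smul_eq_mul, mul_one] at this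

lemma bc_mul_mem {p q r : Submodule K B} (h : ∀ a ∈ p, ∀ b ∈ q, a * b ∈ r)
    {a b : L ⊗[K] B} (ha : a ∈ p.baseChange L) (hb : b ∈ q.baseChange L) :
    a * b ∈ r.baseChange L := by
  refine mem_bc_induction (P := fun a => a * b ∈ r.baseChange L) (by simp)
    (fun a a' h h' => by rw [add_mul]; exact Submodule.add_mem _ h h') ?_ ha
  intro c x hx
  refine mem_bc_induction (P := fun b => (c ⊗ₜ[K] x) * b ∈ r.baseChange L) (by simp)
    (fun a a' h h' => by rw [mul_add]; exact Submodule.add_mem _ h h') ?_ hb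
  intro c' x' hx'
  rw [Algebra.TensorProduct.tmul_mul_tmul]
  exact Submodule.tmul_mem_baseChange_of_mem _ (h _ hx _ hx')

lemma finrank_bc (p : Submodule K B) :
    Module.finrank L (p.baseChange L) = Module.finrank K p := by
  rw [← Module.finrank_baseChange (R := L) (M' := p)]
  exact (LinearEquiv.finrank_eq (Submodule.toBaseChange.toLinearEquiv L p)).symm

end Transfer

section Inst

variable {K L B : Type*} [Field K] [Field L] [Algebra K L] [CommRing B] [Algebra K B]

/-- The generic extension as an instance of the abstract data. -/
noncomputable def mkGA (P : ℕ → Submodule K B) (x : Fin 4 → B)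
    (hmul : ∀ i j, ∀ a ∈ P i, ∀ b ∈ P j, a * b ∈ P (i + j))
    (hx : ∀ j, x j ∈ P 1) (hxs : ∀ b ∈ P 1, ∃ c : Fin 4 → K, b = ∑ i, c i • x i)
    (hone : 1 ∈ P 0) [Nontrivial B]
    (hP2 : ∀ T : Submodule K B, (∀ j, ∀ q ∈ P 1, x j * q ∈ T) → P 2 ≤ T)
    (h1 : Module.finrank K (P 1) = 4) (h2 : Module.finrank K (P 2) = 6)
    (h3 : Module.finrank K (P 3) = 6) (h5 : Module.finrank K (P 5) = 1)
    (hr : ∀ i, i < 5 → ∃ r : Fin 4 → B →ₗ[K] B, ∀ p ∈ P i, p = ∑ j, r j (x j * p))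
    (t : Fin 4 → L) (δ : Fin 4 → L →ₗ[K] L)
    (hδ : ∀ k a b, δ k (a * b) = a * δ k b + b * δ k a)
    (hδt : ∀ k j, δ k (t j) = if k = j then 1 else 0) :
    GA L (L ⊗[K] B) where
  G i := (P i).baseChange L
  mul_mem := by
    intro i j a b ha hb
    exact bc_mul_mem (hmul i j) ha hb
  x j := 1 ⊗ₜ x j
  x_mem j := Submodule.tmul_mem_baseChange_of_mem _ (hx j)
  x_span u hu := by
    refine mem_bc_induction (P := fun u => ∃ c : Fin 4 → L, u = ∑ i,
      algebraMap L (L ⊗[K] B) (c i) * (1 ⊗ₜ x i)) ⟨0, by simp⟩ ?_ ?_ hu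
    · rintro a b ⟨c, rfl⟩ ⟨c', rfl⟩
      refine ⟨c + c', ?_⟩
      simp only [Pi.add_apply, map_add, add_mul, Finset.sum_add_distrib]
    · intro c b hb
      obtain ⟨c', rfl⟩ := hxs b hb
      refine ⟨fun i => c * algebraMap K L (c' i), ?_⟩
      rw [TensorProduct.tmul_sum]
      refine Finset.sum_congr rfl fun i _ => ?_
      rw [Algebra.TensorProduct.algebraMap_apply, Algebra.TensorProduct.tmul_mul_tmul,
        Algebra.algebraMap_self_apply, mul_one, one_mul, ← TensorProduct.smul_tmul, Algebra.smul_def,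
        mul_comm]
  one_mem := Submodule.tmul_mem_baseChange_of_mem _ hone
  one_ne := one_ne_zero
  G2 T hT := by
    apply bc_le
    have : P 2 ≤ (T.restrictScalars K).comap
        (Algebra.TensorProduct.includeRight (R := K) (A := L) (B := B)).toLinearMap := by
      apply hP2
      intro j q hq
      have := hT _ (Submodule.tmul_mem_baseChange_of_mem 1 (hx j)) _
        (Submodule.tmul_mem_baseChange_of_mem 1 hq)
      rwa [Algebra.TensorProduct.tmul_mul_tmul, one_mul] at this
    exact fun b hb => this hb
  fr1 := (finrank_bc _).trans h1
  fr2 := (finrank_bc _).trans h2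
  fr3 := (finrank_bc _).trans h3
  fr5 := (finrank_bc _).trans h5
  nd := by
    intro i hi a ha h
    obtain ⟨r, hr⟩ := hr i hi
    have : a = ∑ j, (r j).baseChange L ((1 ⊗ₜ[K] x j) * a) := by
      refine mem_bc_induction (P := fun a => a = ∑ j, (r j).baseChange L
        ((1 ⊗ₜ[K] x j) * a)) (by simp) ?_ ?_ ha
      · intro a b ha hb
        simp only [mul_add, map_add, Finset.sum_add_distrib]
        rw [← ha, ← hb]
      · intro c b hb
        simp only [Algebra.TensorProduct.tmul_mul_tmul, one_mul, LinearMap.baseChange_tmul]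
        rw [← TensorProduct.tmul_sum, ← hr b hb]
    rw [this]
    refine Finset.sum_eq_zero fun j _ => ?_
    rw [mul_comm, h _ (Submodule.tmul_mem_baseChange_of_mem _ (hx j)), map_zero]
  l := ∑ j, t j ⊗ₜ x j
  l_mem := Submodule.sum_mem _ fun j _ =>
    Submodule.tmul_mem_baseChange_of_mem _ (hx j)
  d k := mkDer _ (rT_leib (δ k) (hδ k))
  d_mem := by
    intro k i a ha
    rw [mkDer_apply]
    refine mem_bc_induction (P := fun a => (LinearMap.rTensor B (δ k)).toAddMonoidHom a ∈
      (P i).baseChange L)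
      (by simp) (fun a b ha hb => by rw [map_add]; exact Submodule.add_mem _ ha hb) ?_ ha
    intro c b hb
    change δ k c ⊗ₜ b ∈ _
    exact Submodule.tmul_mem_baseChange_of_mem _ hb
  d_sc k c := ⟨δ k c, rfl⟩
  d_x k j := by
    have : δ k 1 = 0 := by
      have := hδ k 1 1
      simpa using this
    rw [mkDer_apply]
    change δ k 1 ⊗ₜ x j = 0
    rw [this, TensorProduct.zero_tmul]
  d_l k := by
    rw [mkDer_apply, map_sum]
    change ∑ j, δ k (t j) ⊗ₜ[K] x j = _
    simp only [hδt]
    rw [Finset.sum_eq_single k]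
    · rw [if_pos rfl]
    · intro b _ hb
      rw [if_neg (Ne.symm hb), TensorProduct.zero_tmul]
    · simp

end Inst

open MvPolynomial
open scoped TensorProduct

section Spec

variable {K B : Type*} [Field K] [CommRing B] [Algebra K B]

lemma spec_generic (x : Fin 4 → B) (P Q : Submodule K B) [FiniteDimensional K P]
    [FiniteDimensional K Q] (hPQ : Module.finrank K P = Module.finrank K Q) (k : ℕ)
    (hmul : ∀ e : Fin k → Fin 4, ∀ b ∈ P, (∏ s, x (e s)) * b ∈ Q)
    (hinj : ∀ a ∈ P.baseChange (FractionRing (MvPolynomial (Fin 4) K)),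
      (∑ j, algebraMap (MvPolynomial (Fin 4) K) (FractionRing (MvPolynomial (Fin 4) K)) (X j)
        ⊗ₜ[K] x j) ^ k * a = 0 → a = 0) :
    ∃ p : MvPolynomial (Fin 4) K, p ≠ 0 ∧ ∀ t : Fin 4 → K, eval t p ≠ 0 →
      ∀ a ∈ P, (∑ j, t j • x j) ^ k * a = 0 → a = 0 := by
  let φ := algebraMap (MvPolynomial (Fin 4) K) (FractionRing (MvPolynomial (Fin 4) K))
  have hφ : Function.Injective φ := IsFractionRing.injective _ _
  let r := Module.finrank K P
  let b : Module.Basis (Fin r) K P := Module.finBasis K P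
  let c : Module.Basis (Fin r) K Q := Module.finBasisOfFinrankEq K Q hPQ.symm
  choose f hf using fun p => LinearMap.exists_extend (c.coord p)
  choose g hg using fun p => LinearMap.exists_extend (b.coord p)
  have hf' : ∀ y ∈ Q, y = ∑ p, f p y • (c p : B) := by
    intro y hy
    have h1 := congrArg Q.subtype (c.sum_repr ⟨y, hy⟩)
    rw [map_sum] at h1
    refine h1.symm.trans (Finset.sum_congr rfl fun p _ => ?_)
    rw [map_smul]
    congr 1
    exact (LinearMap.congr_fun (hf p) ⟨y, hy⟩).symm
  have hg' : ∀ p q, g p (b q) = if q = p then 1 else 0 := by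
    intro p q
    have := LinearMap.congr_fun (hg p) (b q)
    rw [LinearMap.comp_apply] at this
    refine this.trans ?_
    rw [Module.Basis.coord_apply, Module.Basis.repr_self, Finsupp.single_apply]
  let M : Matrix (Fin r) (Fin r) (MvPolynomial (Fin 4) K) := fun p q =>
    ∑ e : Fin k → Fin 4, (∏ s, X (e s)) * C (f p ((∏ s, x (e s)) * b q))
  have hM : ∀ {R : Type _} [CommRing R] (ψ : MvPolynomial (Fin 4) K →+* R) (p q : Fin r),
      ψ.mapMatrix M p q = ψ (∑ e : Fin k → Fin 4, (∏ s, X (e s)) *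
        C (f p ((∏ s, x (e s)) * b q))) := fun ψ p q => rfl
  refine ⟨M.det, ?_, ?_⟩
  · intro hdet
    have hdet' : (φ.mapMatrix M).det = 0 := by
      rw [← RingHom.map_det, hdet, map_zero]
    obtain ⟨v, hv, hMv⟩ := Matrix.exists_mulVec_eq_zero_iff.2 hdet'
    have ha : ∑ q, v q ⊗ₜ[K] (b q : B) ∈
        P.baseChange (FractionRing (MvPolynomial (Fin 4) K)) :=
      Submodule.sum_mem _ fun q _ => Submodule.tmul_mem_baseChange_of_mem _ (b q).2
    have h0 := hinj _ ha ?_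
    · apply hv
      ext p
      have := congrArg (fun z => TensorProduct.rid K _ (LinearMap.lTensor _ (g p) z)) h0
      simpa [hg'] using this
    · have e1 : (∑ j, φ (X j) ⊗ₜ[K] x j) ^ k * ∑ q, v q ⊗ₜ[K] (b q : B) =
          ∑ p, ((φ.mapMatrix M).mulVec v p) ⊗ₜ[K] (c p : B) := by
        have e2 : ∀ e : Fin k → Fin 4, ∏ s, (φ (X (e s)) ⊗ₜ[K] x (e s)) =
            (∏ s, φ (X (e s))) ⊗ₜ[K] ∏ s, x (e s) := by
          intro e
          induction (Finset.univ : Finset (Fin k)) using Finset.induction_on with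
          | empty => simp [Algebra.TensorProduct.one_def]
          | insert s S hs ih =>
            rw [Finset.prod_insert hs, Finset.prod_insert hs, Finset.prod_insert hs, ih,
              Algebra.TensorProduct.tmul_mul_tmul]
        rw [Fintype.sum_pow, Finset.sum_mul_sum]
        have e3 : ∀ (e : Fin k → Fin 4) (q : Fin r),
            (∏ s, (φ (X (e s)) ⊗ₜ[K] x (e s))) * v q ⊗ₜ[K] (b q : B) =
            ∑ p, ((∏ s, φ (X (e s))) * algebraMap K _ (f p ((∏ s, x (e s)) * b q)) * v q)
              ⊗ₜ[K] (c p : B) := by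
          intro e q
          rw [e2, Algebra.TensorProduct.tmul_mul_tmul]
          conv_lhs => rw [hf' _ (hmul e _ (b q).2)]
          rw [TensorProduct.tmul_sum]
          refine Finset.sum_congr rfl fun p _ => ?_
          rw [← TensorProduct.smul_tmul, Algebra.smul_def]
          congr 1
          ring
        simp only [e3]
        rw [Finset.sum_congr rfl fun e _ => Finset.sum_comm, Finset.sum_comm]
        refine Finset.sum_congr rfl fun p _ => ?_
        simp only [← TensorProduct.sum_tmul]
        congr 1
        rw [Finset.sum_comm]
        simp only [Matrix.mulVec, dotProduct]
        refine Finset.sum_congr rfl fun q _ => ?_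
        rw [← Finset.sum_mul]
        congr 1
        rw [hM]
        simp only [map_sum, map_mul, map_prod]
        refine Finset.sum_congr rfl fun e _ => ?_
        congr 1
      refine e1.trans ?_
      rw [hMv]
      simp
  · intro t ht a ha h
    have hdet : ((eval t).mapMatrix M).det ≠ 0 := by rwa [← RingHom.map_det]
    have haw : a = ∑ q, b.repr ⟨a, ha⟩ q • (b q : B) := by
      have h1 := congrArg P.subtype (b.sum_repr ⟨a, ha⟩)
      rw [map_sum] at h1
      exact h1.symm
    have hw : (b.repr ⟨a, ha⟩ : Fin r → K) = 0 := by
      apply Matrix.eq_zero_of_mulVec_eq_zero hdet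
      ext p
      have h2 := congrArg (f p) h
      rw [haw, Fintype.sum_pow, Finset.sum_mul_sum, map_zero, Finset.sum_comm, map_sum] at h2
      rw [Pi.zero_apply, ← h2]
      simp only [Matrix.mulVec, dotProduct]
      refine Finset.sum_congr rfl fun q _ => ?_
      rw [hM]
      simp only [map_sum, map_mul, map_prod, eval_X, eval_C]
      rw [Finset.sum_mul]
      refine Finset.sum_congr rfl fun e _ => ?_
      rw [Finset.prod_smul, mul_smul_comm, smul_mul_assoc, map_smul, map_smul]
      simp only [smul_eq_mul]
      ring
    rw [haw]
    exact Finset.sum_eq_zero fun q _ => by rw [hw]; simp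

end Spec

open MvPolynomial
open scoped TensorProduct

section Final

set_option linter.unusedSectionVars false

variable {K : Type*} [Field K] [CharZero K]

lemma pow_mem_piece {n : ℕ} {I : Ideal (MvPolynomial (Fin n) K)}
    {a : MvPolynomial (Fin n) K ⧸ I} (ha : a ∈ piece I 1) (k : ℕ) : a ^ k ∈ piece I k := by
  induction k with
  | zero => rw [pow_zero]; exact one_mem_piece
  | succ k ih => rw [pow_succ]; exact piece_mul_mem ih ha

lemma prod_mem_piece {n : ℕ} {I : Ideal (MvPolynomial (Fin n) K)} (k : ℕ) (e : Fin k → Fin n) :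
    ∏ s, Ideal.Quotient.mk I (X (e s)) ∈ piece I k := by
  rw [← map_prod]
  apply mk_mem_piece
  have := IsHomogeneous.prod (Finset.univ : Finset (Fin k)) (fun s => (X (e s) : MvPolynomial (Fin n) K))
    (fun _ => 1) (fun s _ => isHomogeneous_X _ _)
  simpa using this

lemma exists_point {B : Type*} [CommRing B] [Algebra K B] [Nontrivial B]
    (P : ℕ → Submodule K B) [∀ i, FiniteDimensional K (P i)] (x : Fin 4 → B)
    (hmul : ∀ i j, ∀ a ∈ P i, ∀ b ∈ P j, a * b ∈ P (i + j))
    (hx : ∀ j, x j ∈ P 1) (hxs : ∀ b ∈ P 1, ∃ c : Fin 4 → K, b = ∑ i, c i • x i)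
    (hone : 1 ∈ P 0) (hP0 : P 0 ≤ Submodule.span K {1})
    (hP2 : ∀ T : Submodule K B, (∀ j, ∀ q ∈ P 1, x j * q ∈ T) → P 2 ≤ T)
    (hprod : ∀ k (e : Fin k → Fin 4), ∏ s, x (e s) ∈ P k)
    (h0 : Module.finrank K (P 0) = 1)
    (h1 : Module.finrank K (P 1) = 4) (h2 : Module.finrank K (P 2) = 6)
    (h3 : Module.finrank K (P 3) = 6) (h4 : Module.finrank K (P 4) = 4)
    (h5 : Module.finrank K (P 5) = 1)
    (hr : ∀ i, i < 5 → ∃ r : Fin 4 → B →ₗ[K] B, ∀ p ∈ P i, p = ∑ j, r j (x j * p)) :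
    ∃ t : Fin 4 → K, ∀ i, i ≤ 2 → ∀ a ∈ P i, (∑ j, t j • x j) ^ (5 - 2 * i) * a = 0 → a = 0 := by
  choose δ hδ hδt using exists_der K 4
  have : CharZero (FractionRing (MvPolynomial (Fin 4) K)) :=
    charZero_of_injective_algebraMap
      (algebraMap K (FractionRing (MvPolynomial (Fin 4) K))).injective
  obtain ⟨g, hgG, hgl⟩ : ∃ g : GA (FractionRing (MvPolynomial (Fin 4) K))
      (FractionRing (MvPolynomial (Fin 4) K) ⊗[K] B),
      (∀ i, g.G i = (P i).baseChange _) ∧ g.l = ∑ j, algebraMap (MvPolynomial (Fin 4) K)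
        (FractionRing (MvPolynomial (Fin 4) K)) (X j) ⊗ₜ[K] x j :=
    ⟨mkGA P x hmul hx hxs hone hP2 h1 h2 h3 h5 hr (fun j => algebraMap _ _ (X j)) δ hδ hδt,
      fun i => rfl, rfl⟩
  obtain ⟨p0, hp0, H0⟩ := spec_generic x (P 0) (P 5) (h0.trans h5.symm) 5
    (fun e b hb => hmul 5 0 _ (hprod 5 e) _ hb) (by
      intro a ha h
      rw [← hgl] at h
      have key : ∃ c : FractionRing (MvPolynomial (Fin 4) K), a = c • (1 : _ ⊗[K] B) := by
        refine mem_bc_induction (P := fun a => ∃ c : FractionRing (MvPolynomial (Fin 4) K),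
          a = c • (1 : _ ⊗[K] B)) ⟨0, by simp⟩ ?_ ?_ ha
        · rintro a b ⟨c, rfl⟩ ⟨c', rfl⟩
          exact ⟨c + c', (add_smul _ _ _).symm⟩
        · intro c b hb
          obtain ⟨c', rfl⟩ := Submodule.mem_span_singleton.1 (hP0 hb)
          refine ⟨c' • c, ?_⟩
          rw [← TensorProduct.smul_tmul, Algebra.TensorProduct.one_def, TensorProduct.smul_tmul',
            smul_eq_mul, mul_one]
      obtain ⟨c, rfl⟩ := key
      rw [mul_smul_comm, mul_one] at h
      rcases smul_eq_zero.1 h with h | h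
      · rw [h, zero_smul]
      · exact absurd h g.l5)
  obtain ⟨p1, hp1, H1⟩ := spec_generic x (P 1) (P 4) (h1.trans h4.symm) 3
    (fun e b hb => hmul 3 1 _ (hprod 3 e) _ hb)
    (fun a ha h => g.kappa3 a (by rw [hgG]; exact ha) (by rw [hgl]; exact h))
  obtain ⟨p2, hp2, H2⟩ := spec_generic x (P 2) (P 3) (h2.trans h3.symm) 1
    (fun e b hb => hmul 1 2 _ (hprod 1 e) _ hb)
    (fun a ha h => g.wlp a (by rw [hgG]; exact ha) (by rw [hgl]; rw [pow_one] at h; exact h))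
  have hp : p0 * p1 * p2 ≠ 0 := mul_ne_zero (mul_ne_zero hp0 hp1) hp2
  obtain ⟨t, ht⟩ : ∃ t : Fin 4 → K, eval t (p0 * p1 * p2) ≠ 0 := by
    by_contra! hcon
    exact hp (MvPolynomial.funext fun t => by rw [hcon t, map_zero])
  rw [map_mul, map_mul, mul_ne_zero_iff, mul_ne_zero_iff] at ht
  refine ⟨t, fun i hi => ?_⟩
  interval_cases i
  · exact H0 t ht.1.1
  · exact H1 t ht.1.2
  · exact H2 t ht.2

lemma exists_lin (I : Ideal (MvPolynomial (Fin 4) K))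
    (hAG : IsArtinianGorenstein I 5)
    (h0 : hf I 0 = 1) (h1 : hf I 1 = 4) (h2 : hf I 2 = 6)
    (h3 : hf I 3 = 6) (h4 : hf I 4 = 4) (h5 : hf I 5 = 1) :
    ∃ ℓ : MvPolynomial (Fin 4) K, ℓ.IsHomogeneous 1 ∧
      ∀ i, i ≤ 2 → ∀ a ∈ piece I i, Ideal.Quotient.mk I ℓ ^ (5 - 2 * i) * a = 0 → a = 0 := by
  have : Nontrivial (MvPolynomial (Fin 4) K ⧸ I) := by
    by_contra hcon
    rw [not_nontrivial_iff_subsingleton] at hcon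
    have : hf I 0 = 0 := Module.finrank_zero_of_subsingleton
    omega
  have hxs : ∀ b ∈ piece I 1, ∃ c : Fin 4 → K, b = ∑ i, c i • Ideal.Quotient.mk I (X i) := by
    intro b hb
    have : piece I (0 + 1) ≤ Submodule.span K (Set.range fun j => Ideal.Quotient.mk I (X j)) := by
      apply piece_succ_le
      intro j q hq
      obtain ⟨c, rfl⟩ := Submodule.mem_span_singleton.1 (piece_zero_le hq)
      rw [mul_smul_comm, mul_one]
      exact Submodule.smul_mem _ _ (Submodule.subset_span ⟨j, rfl⟩)
    obtain ⟨c, hc⟩ := (Submodule.mem_span_range_iff_exists_fun K).1 (this hb)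
    exact ⟨c, hc.symm⟩
  obtain ⟨t, ht⟩ := exists_point (piece I) (fun j => Ideal.Quotient.mk I (X j))
    (fun i j a ha b hb => piece_mul_mem ha hb) X_mem_piece hxs one_mem_piece piece_zero_le
    (fun T hT => piece_succ_le T hT) prod_mem_piece h0 h1 h2 h3 h4 h5
    (fun i hi => exists_red hAG.1 hAG.2.2.2.2.2 (by omega))
  have hl : Ideal.Quotient.mk I (∑ j, t j • X j) = ∑ j, t j • Ideal.Quotient.mk I (X j) := by
    rw [map_sum]; rfl
  refine ⟨∑ j, t j • X j, ?_, ?_⟩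
  · rw [← mem_homogeneousSubmodule]
    exact Submodule.sum_mem _ fun j _ => Submodule.smul_mem _ _ (isHomogeneous_X _ _)
  · rw [hl]
    exact ht

lemma surj_of_inj {I : Ideal (MvPolynomial (Fin 4) K)} {i j k : ℕ} (hij : hf I i = hf I j)
    (hk : k + i = j)
    {l : MvPolynomial (Fin 4) K ⧸ I} (hl : l ∈ piece I 1)
    (h : ∀ a ∈ piece I i, l ^ k * a = 0 → a = 0) :
    ∀ b ∈ piece I j, ∃ a ∈ piece I i, l ^ k * a = b := by
  subst hk
  let f : piece I i →ₗ[K] piece I (k + i) :=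
    (LinearMap.mulLeft K (l ^ k)).restrict
      (fun a ha => piece_mul_mem (pow_mem_piece hl k) ha)
  have hinj : Function.Injective f := by
    rw [← LinearMap.ker_eq_bot, LinearMap.ker_eq_bot']
    rintro ⟨a, ha⟩ hfa
    exact Subtype.ext (h a ha (congrArg Subtype.val hfa))
  have hsurj := (LinearMap.injective_iff_surjective_of_finrank_eq_finrank hij).1 hinj
  intro b hb
  obtain ⟨a, ha⟩ := hsurj ⟨b, hb⟩
  exact ⟨a, a.2, congrArg Subtype.val ha⟩

end Final

/-- Any artinian Gorenstein algebra with h-vector `(1,4,6,6,4,1)` has the SLP. -/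
theorem slp_146641 {K : Type*} [Field K] [IsAlgClosed K] [CharZero K]
    (I : Ideal (MvPolynomial (Fin 4) K))
    (hAG : IsArtinianGorenstein I 5)
    (h0 : hf I 0 = 1) (h1 : hf I 1 = 4) (h2 : hf I 2 = 6)
    (h3 : hf I 3 = 6) (h4 : hf I 4 = 4) (h5 : hf I 5 = 1) :
    SLP I := by
  obtain ⟨ℓ, hℓ, H⟩ := exists_lin I hAG h0 h1 h2 h3 h4 h5
  have hl : Ideal.Quotient.mk I ℓ ∈ piece I 1 := mk_mem_piece hℓ
  refine ⟨ℓ, hℓ, fun i k hk => ?_⟩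
  by_cases c1 : 5 < i + k
  · right
    have hz : piece I (i + k) = ⊥ := Submodule.finrank_eq_zero.1 (hAG.2.2.1 _ c1)
    intro b hb
    rw [hz, Submodule.mem_bot] at hb
    exact ⟨0, Submodule.zero_mem _, by rw [hb, mul_zero]⟩
  by_cases c2 : i + k ≤ 5 - i
  · left
    intro a ha h
    refine H i (by omega) a ha ?_
    have e : 5 - 2 * i = (5 - 2 * i - k) + k := by omega
    rw [e, pow_add, mul_assoc, h, mul_zero]
  · right
    obtain ⟨i', hi'⟩ : ∃ i', i' = 5 - (i + k) := ⟨_, rfl⟩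
    have e1 : hf I i' = hf I (i + k) := by
      rw [hAG.2.2.2.1 i' (by omega)]
      congr 1
      omega
    have hs := surj_of_inj e1 (k := 5 - 2 * i') (by omega) hl (H i' (by omega))
    intro b hb
    obtain ⟨a, ha, rfl⟩ := hs b hb
    refine ⟨Ideal.Quotient.mk I ℓ ^ (i - i') * a, ?_, ?_⟩
    · have := piece_mul_mem (pow_mem_piece hl (i - i')) ha
      rwa [show i - i' + i' = i by omega] at this
    · rw [← mul_assoc, ← pow_add]
      congr 2
      omega
end

section
/- Any artinian Gorenstein algebra A over an algebraically closed field of characteristic zero with h-vector (1, 5, 5, ..., 5, 1) of socle degree d, where d = 2 or d ≥ 4, has the strong Lefschetz property. -/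
open MvPolynomial

section core
variable {K A : Type*} [Field K] [CommRing A] [Algebra K A]

/-- injectivity is open along lines -/
lemma inj_line {P W : Type*} [AddCommGroup P] [Module K P] [FiniteDimensional K P]
    [AddCommGroup W] [Module K W] (f g : P →ₗ[K] W) (hf : Function.Injective f) :
    {t : K | ¬ Function.Injective (f + t • g)}.Finite := by
  obtain ⟨h, hh⟩ := LinearMap.exists_leftInverse_of_injective f (LinearMap.ker_eq_bot.2 hf)
  have hfin : {μ : K | Module.End.HasEigenvalue (h ∘ₗ g) μ}.Finite :=
    Module.End.finite_hasEigenvalue _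
  refine (hfin.image (fun μ => -μ⁻¹)).subset ?_
  intro t ht
  simp only [Set.mem_ofPred_eq] at ht
  rw [← LinearMap.ker_eq_bot, ← ne_eq, Submodule.ne_bot_iff] at ht
  obtain ⟨x, hx, hx0⟩ := ht
  rw [LinearMap.mem_ker] at hx
  have h1 : x + t • h (g x) = 0 := by
    have := congrArg h hx
    simp only [LinearMap.add_apply, LinearMap.smul_apply, map_add, map_smul, map_zero] at this
    rwa [show h (f x) = x from LinearMap.congr_fun hh x] at this
  have ht0 : t ≠ 0 := by
    rintro rfl
    simp at h1; exact hx0 h1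
  refine ⟨-t⁻¹, ?_, by simp⟩
  refine Module.End.hasEigenvalue_of_hasEigenvector (x := x) ⟨?_, hx0⟩
  rw [Module.End.mem_eigenspace_iff]
  have : h (g x) = t⁻¹ • (t • h (g x)) := by rw [smul_smul, inv_mul_cancel₀ ht0, one_smul]
  rw [LinearMap.comp_apply, this, eq_neg_of_add_eq_zero_right h1]; simp

lemma rank_line {P W : Type*} [AddCommGroup P] [Module K P] [FiniteDimensional K P]
    [AddCommGroup W] [Module K W] (f g : P →ₗ[K] W) :
    {t : K | ¬ Module.finrank K (LinearMap.range f) ≤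
      Module.finrank K (LinearMap.range (f + t • g))}.Finite := by
  obtain ⟨Q, hQ⟩ := Submodule.exists_isCompl (LinearMap.ker f)
  have hinj : Function.Injective (f ∘ₗ Q.subtype) := by
    rw [← LinearMap.ker_eq_bot, LinearMap.ker_comp, ← Submodule.disjoint_iff_comap_eq_bot]
    exact hQ.symm.disjoint
  refine (inj_line _ (g ∘ₗ Q.subtype) hinj).subset ?_
  intro t ht hcon
  apply ht
  have h1 := Submodule.finrank_add_eq_of_isCompl hQ
  have h2 := LinearMap.finrank_range_add_finrank_ker f
  have h3 := LinearMap.finrank_range_of_inj hcon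
  have h4 : LinearMap.range (f ∘ₗ Q.subtype + t • g ∘ₗ Q.subtype) ≤ LinearMap.range (f + t • g) := by
    rintro _ ⟨x, rfl⟩
    exact ⟨x, rfl⟩
  have h5 := Submodule.finrank_mono h4
  omega

lemma lemG [Infinite K] {P W : Type*} [AddCommGroup P] [Module K P] [FiniteDimensional K P]
    [AddCommGroup W] [Module K W] (f g : P →ₗ[K] W) (y : W)
    (hr : ∀ t : K, Module.finrank K (LinearMap.range (f + t • g)) ≤
      Module.finrank K (LinearMap.range f))
    (hy : ∀ t : K, t ≠ 0 → y ∈ LinearMap.range (f + t • g)) : y ∈ LinearMap.range f := by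
  by_contra hyf
  obtain ⟨Q, hQ⟩ := Submodule.exists_isCompl (LinearMap.ker f)
  let F : Q × K →ₗ[K] W := (f ∘ₗ Q.subtype).coprod (LinearMap.toSpanSingleton K W y)
  let G : Q × K →ₗ[K] W := (g ∘ₗ Q.subtype).coprod 0
  have hinj : Function.Injective F := by
    rw [← LinearMap.ker_eq_bot, Submodule.eq_bot_iff]
    rintro ⟨q, c⟩ hqc
    have hqc' : f q + c • y = 0 := by simpa [F] using hqc
    have hc : c = 0 := by
      by_contra hc
      apply hyf
      refine ⟨-(c⁻¹ • (q : P)), ?_⟩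
      rw [map_neg, map_smul, eq_neg_of_add_eq_zero_left hqc', smul_neg, smul_smul,
        inv_mul_cancel₀ hc]; simp
    subst hc
    have : (q : P) ∈ LinearMap.ker f ⊓ Q := ⟨by simpa using hqc', q.2⟩
    rw [hQ.inf_eq_bot] at this
    have : q = 0 := by simpa using this
    simp [this]
  have hfin := (inj_line F G hinj).union (Set.finite_singleton (0 : K))
  obtain ⟨t, ht⟩ := hfin.exists_notMem
  simp only [Set.mem_union, Set.mem_ofPred_eq, Set.mem_singleton_iff, not_or, not_not] at ht
  obtain ⟨ht, ht0⟩ := ht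
  have h1 := Submodule.finrank_add_eq_of_isCompl hQ
  have h2 := LinearMap.finrank_range_add_finrank_ker f
  have h3 := LinearMap.finrank_range_of_inj ht
  rw [Module.finrank_prod, Module.finrank_self] at h3
  have h4 : LinearMap.range (F + t • G) ≤ LinearMap.range (f + t • g) := by
    rintro _ ⟨⟨q, c⟩, rfl⟩
    have : (F + t • G) (q, c) = (f + t • g) q + c • y := by
      simp [F, G]; abel
    rw [this]
    exact Submodule.add_mem _ ⟨q, rfl⟩ (Submodule.smul_mem _ _ (hy t ht0))
  have h5 := Submodule.finrank_mono h4
  have h6 := hr t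
  omega

/-- open along lines -/
def LO {V : Type*} [AddCommGroup V] [Module K V] (S : Set V) : Prop :=
  ∀ x ∈ S, ∀ m : V, {t : K | x + t • m ∉ S}.Finite

lemma LO.inter {V : Type*} [AddCommGroup V] [Module K V] {S T : Set V}
    (hS : LO (K := K) S) (hT : LO (K := K) T) : LO (K := K) (S ∩ T) := by
  intro x hx m
  refine ((hS x hx.1 m).union (hT x hx.2 m)).subset ?_
  intro t ht
  by_contra h
  simp only [Set.mem_union, Set.mem_ofPred_eq, not_or, not_not] at h
  exact ht h

lemma LO.nonempty [Infinite K] {V : Type*} [AddCommGroup V] [Module K V] {S T : Set V}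
    (hS : LO (K := K) S) (hT : LO (K := K) T) (nS : S.Nonempty) (nT : T.Nonempty) :
    (S ∩ T).Nonempty := by
  obtain ⟨x, hx⟩ := nS
  obtain ⟨y, hy⟩ := nT
  have h1 := hS x hx (y - x)
  have h2 := (hT y hy (x - y)).image (fun t => 1 - t)
  obtain ⟨t, ht⟩ := (h1.union h2).exists_notMem
  simp only [Set.mem_union, Set.mem_ofPred_eq, Set.mem_image, not_or, not_not, not_exists,
    not_and] at ht
  refine ⟨x + t • (y - x), ht.1, ?_⟩
  by_contra hc
  refine ht.2 (1 - t) ?_ (by ring)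
  convert hc using 2
  module

/-- A vector-valued polynomial with nonzero constant term vanishes at finitely many points. -/
lemma poly_finite (p : Polynomial A) (hp : p ≠ 0) :
    {t : K | p.eval (algebraMap K A t) = 0}.Finite := by
  obtain ⟨n, hn⟩ : ∃ n, p.coeff n ≠ 0 := by
    by_contra h
    push Not at h
    exact hp (Polynomial.ext (by simpa using h))
  obtain ⟨φ, hφ⟩ : ∃ φ : Module.Dual K A, φ (p.coeff n) ≠ 0 := by
    by_contra h
    push Not at h
    exact hn ((Module.forall_dual_apply_eq_zero_iff K _).1 h)
  let r : Polynomial K := ∑ i ∈ Finset.range (p.natDegree + 1), Polynomial.monomial i (φ (p.coeff i))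
  have hr : r ≠ 0 := by
    intro h
    have := congrArg (fun s => Polynomial.coeff s n) h
    simp only [r, Polynomial.finsetSum_coeff, Polynomial.coeff_monomial, Finset.sum_ite_eq',
      Finset.mem_range, Polynomial.coeff_zero] at this
    rw [if_pos] at this
    · exact hφ this
    · exact Nat.lt_succ_of_le (Polynomial.le_natDegree_of_ne_zero hn)
  refine (r.rootSet_finite K).subset ?_
  intro t ht
  rw [Polynomial.mem_rootSet]
  refine ⟨hr, ?_⟩
  simp only [Set.mem_ofPred_eq] at ht
  rw [Polynomial.eval_eq_sum_range] at ht
  have := congrArg φ ht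
  rw [map_sum, map_zero] at this
  rw [Polynomial.coe_aeval_eq_eval, Polynomial.eval_finsetSum, ← this]
  refine Finset.sum_congr rfl fun i _ => ?_
  rw [Polynomial.eval_monomial, ← map_pow, mul_comm (p.coeff i), ← Algebra.smul_def, map_smul,
    smul_eq_mul, mul_comm]

lemma LO_pow (V : Submodule K A) (d : ℕ) : LO (K := K) {x : V | (x : A) ^ d ≠ 0} := by
  intro x hx m
  refine (poly_finite ((Polynomial.C (x : A) + Polynomial.X * Polynomial.C (m : A)) ^ d) ?_).subset ?_
  · intro h
    have := congrArg (Polynomial.eval 0) h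
    simp at this
    exact hx this
  · intro t ht
    simp only [Set.mem_ofPred_eq, not_not] at ht ⊢
    simpa [Algebra.smul_def, mul_comm (algebraMap K A t)] using ht

/-- multiplication by `x` on `V` -/
def mu (V : Submodule K A) (x : V) : V →ₗ[K] A := (LinearMap.mulLeft K (x : A)) ∘ₗ V.subtype

@[simp] lemma mu_apply (V : Submodule K A) (x y : V) : mu V x y = (x : A) * y := rfl

lemma mu_line (V : Submodule K A) (x m : V) (t : K) : mu V (x + t • m) = mu V x + t • mu V m := by
  ext y; simp [add_mul]

/-- maximal rank elements -/
def MR (V : Submodule K A) : Set V :=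
  {x | ∀ m : V, Module.finrank K (LinearMap.range (mu V m)) ≤
    Module.finrank K (LinearMap.range (mu V x))}

lemma MR_nonempty (V : Submodule K A) [FiniteDimensional K V] : (MR V).Nonempty := by
  have hb : BddAbove (Set.range fun m : V => Module.finrank K (LinearMap.range (mu V m))) := by
    refine ⟨Module.finrank K V, ?_⟩
    rintro _ ⟨m, rfl⟩
    exact LinearMap.finrank_range_le _
  obtain ⟨x, hx⟩ := Nat.sSup_mem (Set.range_nonempty _) hb
  refine ⟨x, fun m => ?_⟩
  simp only at hx
  rw [hx]
  exact le_csSup hb ⟨m, rfl⟩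

lemma LO_MR (V : Submodule K A) [FiniteDimensional K V] : LO (K := K) (MR V) := by
  intro x hx m
  refine (rank_line (mu V x) (mu V m)).subset ?_
  intro t ht hle
  apply ht
  intro n
  rw [mu_line]
  exact (hx n).trans hle

lemma exists_pow_ne [CharZero K] (V : Submodule K A) (d : ℕ) (hd : 1 ≤ d)
    (hnd : ∀ i < d, ∀ a ∈ V ^ i, (∀ m ∈ V, m * a = 0) → a = 0) (hV : V ≠ ⊥) :
    ∃ x : V, (x : A) ^ d ≠ 0 := by
  by_contra hcon
  push Not at hcon
  have key : ∀ j, j < d → ∀ x : V, (x : A) ^ (d - j) = 0 := by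
    intro j
    induction j with
    | zero => intro _ x; simpa using hcon x
    | succ j ih =>
      intro hj x
      obtain ⟨e, he⟩ : ∃ e, d - j = e + 1 := ⟨d - j - 1, by omega⟩
      have he' : d - (j + 1) = e := by omega
      rw [he']
      have ih := ih (by omega)
      rw [he] at ih
      refine hnd e (by omega) _ (Submodule.pow_mem_pow V x.2 e) fun m hm => ?_
      let p : Polynomial A := (Polynomial.C (x : A) + Polynomial.X * Polynomial.C (m : A)) ^ (e + 1)
      have hp : p = 0 := by
        by_contra hp
        have := poly_finite (K := K) p hp
        refine Set.infinite_univ (α := K) (this.subset ?_)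
        intro t _
        have := ih (x + t • ⟨m, hm⟩)
        simpa [p, Algebra.smul_def, mul_comm (algebraMap K A t)] using this
      have h1 := congrArg (fun s => Polynomial.eval 0 (Polynomial.derivative s)) hp
      simp [p, Polynomial.derivative_pow] at h1
      have h2 : ((e + 1 : ℕ) : K) • (m * (x : A) ^ e) = 0 := by
        rw [Algebra.smul_def, ← h1]; push_cast; ring
      exact (smul_eq_zero.1 h2).resolve_left (by exact_mod_cast Nat.succ_ne_zero e)
  apply hV
  rw [Submodule.eq_bot_iff]
  intro x hx
  have := key (d - 1) (by omega) ⟨x, hx⟩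
  rwa [show d - (d - 1) = 1 by omega, pow_one] at this

lemma dim_aux {P W : Type*} [AddCommGroup P] [Module K P] [FiniteDimensional K P]
    [AddCommGroup W] [Module K W] (g : P →ₗ[K] W) (R : Submodule K W)
    (hR : R ≤ LinearMap.range g) (k : P) (hk : k ≠ 0) (hgk : g k = 0) :
    Module.finrank K R + 1 ≤ Module.finrank K P := by
  have h1 := LinearMap.finrank_range_add_finrank_ker g
  have h2 := Submodule.finrank_mono hR
  have h3 : 0 < Module.finrank K (LinearMap.ker g) :=
    Module.finrank_pos_iff_exists_ne_zero.2 ⟨⟨k, hgk⟩, fun h => hk (congrArg Subtype.val h)⟩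
  omega

lemma dim_aux2 {P W : Type*} [AddCommGroup P] [Module K P] [FiniteDimensional K P]
    [AddCommGroup W] [Module K W] (f g : P →ₗ[K] W) (hle : LinearMap.range g ≤ LinearMap.range f)
    (hU : ∀ u, f u ∈ LinearMap.range g → g u = 0) (k : P) (hk : k ≠ 0) (hfk : f k = 0)
    (l : P) (hl : g l = 0) (hl' : f l ∉ LinearMap.range g) :
    2 * Module.finrank K (LinearMap.range g) + 2 ≤ Module.finrank K P := by
  have hUle : (LinearMap.range g).comap f < LinearMap.ker g := by
    refine lt_of_le_of_ne (fun u hu => hU u hu) ?_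
    intro h
    apply hl'
    change l ∈ (LinearMap.range g).comap f
    rw [h]; exact hl
  have h1 := Submodule.finrank_lt_finrank_of_lt hUle
  have h2 := LinearMap.finrank_range_add_finrank_ker g
  have h3 := dim_aux (f ∘ₗ ((LinearMap.range g).comap f).subtype) (LinearMap.range g) (by
      rintro _ ⟨m, rfl⟩
      obtain ⟨v, hv⟩ := hle ⟨m, rfl⟩
      exact ⟨⟨v, m, hv.symm⟩, hv⟩) ⟨k, 0, by rw [hfk, map_zero]⟩
    (fun h => hk (congrArg Subtype.val h)) hfk
  omega

lemma stepA [CharZero K] (V : Submodule K A) (d : ℕ) (hd : 4 ≤ d)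
    (hnd : ∀ i < d, ∀ a ∈ V ^ i, (∀ m ∈ V, m * a = 0) → a = 0) (hV : Module.finrank K V = 5)
    (l k : V) (hl : l ∈ MR V) (hld : (l : A) ^ d ≠ 0) (hk : k ≠ 0) (hlk : (l : A) * k = 0) :
    (k : A) * k = 0 ∧ Module.finrank K (LinearMap.range (mu V k)) ≤ 1 := by
  have hfd : FiniteDimensional K V := Module.finite_of_finrank_pos (by omega)
  have hinf : Infinite K := inferInstance
  have mul_mem2 : ∀ a b : V, (a : A) * b ∈ V ^ 2 := fun a b => by
    rw [pow_two]; exact Submodule.mul_mem_mul a.2 b.2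
  have A1 : ∀ m : V, ∃ v : V, (l : A) * v = m * k := by
    intro m
    have := lemG (mu V l) (mu V m) ((m : A) * k)
      (fun t => by rw [← mu_line]; exact hl _) (fun t ht => by
        refine ⟨t⁻¹ • k, ?_⟩
        simp [hlk, smul_smul, ht])
    obtain ⟨v, hv⟩ := this
    exact ⟨v, hv⟩
  have A2 : ∀ m v : V, (l : A) * v = m * k → ∃ z : V, (l : A) * z = m * v := by
    intro m v hv
    have := lemG (mu V l) (mu V m) ((m : A) * v)
      (fun t => by rw [← mu_line]; exact hl _) (fun t ht => by
        refine ⟨t⁻¹ • v - (t⁻¹ * t⁻¹) • k, ?_⟩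
        simp [hlk, smul_smul, ht, mul_sub, hv, smul_sub])
    obtain ⟨z, hz⟩ := this
    exact ⟨z, hz⟩
  have hk2 : (k : A) * k = 0 := by
    refine hnd 2 (by omega) _ (mul_mem2 k k) fun m hm => ?_
    obtain ⟨v, hv⟩ := A1 ⟨m, hm⟩
    simp only at hv
    linear_combination (-(k : A)) * hv + (v : A) * hlk
  have A3 : ∀ m v : V, (l : A) * v = m * k → (k : A) * v = 0 := by
    intro m v hv
    refine hnd 2 (by omega) _ (mul_mem2 k v) fun n hn => ?_
    obtain ⟨v', hv'⟩ := A1 ⟨n, hn⟩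
    obtain ⟨z, hz⟩ := A2 m v hv
    obtain ⟨z', hz'⟩ := A2 _ v' hv'
    obtain ⟨z'', hz''⟩ := A2 (m + ⟨n, hn⟩) (v + v') (by
      push_cast; rw [mul_add, hv, hv']; ring)
    push_cast at hz'' hz hz' hv'
    have : (2 : K) • (n * ((k : A) * v)) = 0 := by
      rw [Algebra.smul_def, map_ofNat]
      linear_combination (k : A) * (hz + hz' - hz'') - (z + z' - z'') * hlk + v' * hv - v * hv'
    exact (smul_eq_zero.1 this).resolve_left two_ne_zero
  refine ⟨hk2, ?_⟩
  have hdim := dim_aux2 (mu V l) (mu V k) (by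
      rintro _ ⟨m, rfl⟩
      obtain ⟨v, hv⟩ := A1 m
      exact ⟨v, by rw [mu_apply, mu_apply, hv, mul_comm]⟩) (by
      rintro u ⟨m, hm⟩
      refine A3 m u ?_
      rw [mu_apply, mu_apply] at hm
      rw [← hm, mul_comm]) k hk hlk l (by rw [mu_apply, mul_comm, hlk]) (by
      rintro ⟨m, hm⟩
      rw [mu_apply, mu_apply] at hm
      apply hld
      obtain ⟨e, rfl⟩ : ∃ e, d = e + 3 := ⟨d - 3, by omega⟩
      have : (l : A) ^ 3 = 0 := by linear_combination (-(l : A)) * hm + m * hlk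
      rw [pow_add, this, mul_zero])
  omega

/-- rank one elements -/
lemma stepB (V : Submodule K A) (d : ℕ) (hd : 4 ≤ d)
    (hnd : ∀ i < d, ∀ a ∈ V ^ i, (∀ m ∈ V, m * a = 0) → a = 0) [FiniteDimensional K V]
    (k : V) (hk : k ≠ 0) (hr : Module.finrank K (LinearMap.range (mu V k)) ≤ 1) :
    ∃ (f : V →ₗ[K] K) (b : V), f b = 1 ∧ (∀ a : V, (k : A) * a = f a • ((k : A) * b)) ∧
      ∀ j < d, (k : A) * (b : A) ^ j ≠ 0 := by
  have hkA : (k : A) ≠ 0 := by simpa using hk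
  obtain ⟨b, hb⟩ : ∃ b : V, (k : A) * b ≠ 0 := by
    by_contra h
    push Not at h
    exact hkA (hnd 1 (by omega) _ (by simp) fun m hm => by
      rw [mul_comm]; exact h ⟨m, hm⟩)
  obtain ⟨φ, hφ⟩ : ∃ φ : Module.Dual K A, φ ((k : A) * b) ≠ 0 := by
    by_contra h
    push Not at h
    exact hb ((Module.forall_dual_apply_eq_zero_iff K _).1 h)
  have key : ∀ a : V, ∃ c : K, c • ((k : A) * b) = (k : A) * a := by
    intro a
    obtain ⟨v, hv⟩ := finrank_le_one_iff.1 hr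
    obtain ⟨c, hc⟩ := hv ⟨_, a, rfl⟩
    obtain ⟨c', hc'⟩ := hv ⟨_, b, rfl⟩
    have hc := congrArg (Submodule.subtype _) hc
    have hc' := congrArg (Submodule.subtype _) hc'
    simp only [mu_apply, map_smul, Submodule.subtype_apply] at hc hc'
    have : c' ≠ 0 := by
      rintro rfl
      rw [zero_smul] at hc'
      exact hb hc'.symm
    refine ⟨c * c'⁻¹, ?_⟩
    rw [← hc, ← hc', smul_smul, mul_assoc, inv_mul_cancel₀ this, mul_one]
  let f : V →ₗ[K] K := (φ ((k : A) * b))⁻¹ • (φ ∘ₗ mu V k)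
  have hf : ∀ a : V, (k : A) * a = f a • ((k : A) * b) := by
    intro a
    obtain ⟨c, hc⟩ := key a
    have : f a = c := by
      simp only [f, LinearMap.smul_apply, LinearMap.comp_apply, mu_apply, ← hc, map_smul,
        smul_eq_mul]
      field_simp
    rw [this, hc]
  refine ⟨f, b, ?_, hf, ?_⟩
  · simp only [f, LinearMap.smul_apply, LinearMap.comp_apply, mu_apply, smul_eq_mul]
    field_simp
  · intro j
    induction j with
    | zero => intro _; simpa using hkA
    | succ j ih =>
      intro hj h
      refine ih (by omega) (hnd (j + 1) hj _ ?_ fun m hm => ?_)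
      · rw [pow_succ']
        exact Submodule.mul_mem_mul k.2 (Submodule.pow_mem_pow V b.2 j)
      · have := hf ⟨m, hm⟩
        simp only at this
        calc m * ((k : A) * (b : A) ^ j) = (k * m) * (b : A) ^ j := by ring
          _ = f ⟨m, hm⟩ • ((k : A) * (b : A) ^ (j + 1)) := by
            rw [this, smul_mul_assoc]; congr 1; ring
          _ = 0 := by rw [h, smul_zero]

lemma stepC (V : Submodule K A) (d : ℕ) (hd : 4 ≤ d)
    (hnd : ∀ i < d, ∀ a ∈ V ^ i, (∀ m ∈ V, m * a = 0) → a = 0)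
    (hVd : Module.finrank K (V ^ d : Submodule K A) = 1)
    (k k' b b' : V) (f f' : V →ₗ[K] K) (hb' : f' b' = 1)
    (hf : ∀ a : V, (k : A) * a = f a • ((k : A) * b))
    (hf' : ∀ a : V, (k' : A) * a = f' a • ((k' : A) * b'))
    (hkk : ∀ x y : K, x • k + y • k' = 0 → x = 0 ∧ y = 0) :
    ∃ a : V, f a = 0 ∧ f' a ≠ 0 := by
  by_contra hcon
  push Not at hcon
  obtain ⟨c, hc⟩ : ∃ c : K, c • f = f' := by
    have : LinearMap.ker f ≤ LinearMap.ker f' := fun a ha => hcon a ha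
    have := (LinearMap.range_dualMap_eq_dualAnnihilator_ker f)
    have h2 : f' ∈ LinearMap.range f.dualMap := by
      rw [this, Submodule.mem_dualAnnihilator]
      exact fun a ha => hcon a ha
    obtain ⟨g, hg⟩ := h2
    refine ⟨g 1, ?_⟩
    ext a
    rw [← hg, LinearMap.dualMap_apply, LinearMap.smul_apply, smul_eq_mul, mul_comm, ← smul_eq_mul,
      ← map_smul, smul_eq_mul, mul_one]
  have hcb : c * f b' = 1 := by rw [← hb', ← hc]; simp
  -- normalise
  have hg : ∀ a : V, (k' : A) * a = f a • ((c : K) • ((k' : A) * b')) := by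
    intro a
    rw [hf', ← hc, smul_smul]; simp [mul_comm]
  have hg0 : ∀ a : V, (k : A) * a = f a • ((c : K) • ((k : A) * b')) := by
    intro a
    rw [hf a, hf b', smul_smul, smul_smul, mul_assoc, hcb, mul_one]
  have hfin : Module.Finite K (V ^ d : Submodule K A) := Module.finite_of_finrank_pos (by omega)
  obtain ⟨v, hv⟩ := finrank_le_one_iff.1 hVd.le
  have hmem : ∀ q : V, (q : A) * (b' : A) ^ (d - 1) ∈ V ^ d := by
    intro q
    have : d = (d - 1) + 1 := by omega
    rw [this, pow_succ', Nat.add_sub_cancel]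
    exact Submodule.mul_mem_mul q.2 (Submodule.pow_mem_pow V b'.2 _)
  obtain ⟨x, hx⟩ := hv ⟨_, hmem k⟩
  obtain ⟨y, hy⟩ := hv ⟨_, hmem k'⟩
  have hx := congrArg (Submodule.subtype _) hx
  have hy := congrArg (Submodule.subtype _) hy
  simp only [map_smul, Submodule.subtype_apply] at hx hy
  have main : ∀ α β : K, (α • (k : A) + β • (k' : A)) * (b' : A) ^ (d - 1) = 0 →
      α = 0 ∧ β = 0 := by
    intro α β h
    apply hkk
    have hdesc : ∀ j, j < d → ((α • k + β • k' : V) : A) * (b' : A) ^ (d - 1 - j) = 0 := by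
      intro j
      induction j with
      | zero => intro _; simpa using h
      | succ j ih =>
        intro hj
        obtain ⟨e, he⟩ : ∃ e, d - 1 - j = e + 1 := ⟨d - 1 - j - 1, by omega⟩
        have he' : d - 1 - (j + 1) = e := by omega
        have ih := ih (by omega)
        rw [he] at ih
        rw [he']
        refine hnd (e + 1) (by omega) _ ?_ fun m hm => ?_
        · rw [pow_succ' V]
          exact Submodule.mul_mem_mul (α • k + β • k').2 (Submodule.pow_mem_pow V b'.2 e)
        · have h1 := hg ⟨m, hm⟩
          have h2 := hg0 ⟨m, hm⟩
          simp only [Algebra.smul_def] at h1 h2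
          push_cast at ih ⊢
          simp only [Algebra.smul_def] at ih ⊢
          rw [pow_succ'] at ih
          linear_combination (algebraMap K A α) * (b' : A) ^ e * h2 +
            (algebraMap K A β) * (b' : A) ^ e * h1 +
            algebraMap K A (f ⟨m, hm⟩) * algebraMap K A c * ih
    have := hdesc (d - 1) (by omega)
    simp only [Nat.sub_self, pow_zero, mul_one] at this
    exact Subtype.ext this
  have h1 := main y (-x) (by
    rw [add_mul, smul_mul_assoc, smul_mul_assoc, ← hx, ← hy, smul_smul, smul_smul, ← add_smul]
    rw [show y * x + -x * y = 0 by ring, zero_smul])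
  have hy0 : y = 0 := h1.1
  have h2 := main 0 1 (by
    rw [zero_smul, one_smul, zero_add, ← hy, hy0, zero_smul])
  exact one_ne_zero h2.2

lemma prod_rank_one (V : Submodule K A) (k b : V) (f : V →ₗ[K] K)
    (hf : ∀ a : V, (k : A) * a = f a • ((k : A) * b)) {ι : Type*} (s : Finset ι) (a : ι → V) :
    (k : A) * ∏ i ∈ s, (a i : A) = (∏ i ∈ s, f (a i)) • ((k : A) * (b : A) ^ s.card) := by
  classical
  induction s using Finset.induction_on with
  | empty => simp
  | insert i s hi ih =>
    rw [Finset.prod_insert hi, Finset.prod_insert hi, Finset.card_insert_of_notMem hi]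
    calc (k : A) * (a i * ∏ j ∈ s, (a j : A)) = (k * ∏ j ∈ s, (a j : A)) * a i := by ring
      _ = (∏ i ∈ s, f (a i)) • ((k * a i) * (b : A) ^ s.card) := by
        rw [ih, smul_mul_assoc]; congr 1; ring
      _ = _ := by
        rw [hf (a i), smul_mul_assoc, smul_smul, mul_comm (f (a i))]; congr 1; ring

lemma exists_four [CharZero K] (V : Submodule K A) (d : ℕ) (hd : 4 ≤ d)
    (hnd : ∀ i < d, ∀ a ∈ V ^ i, (∀ m ∈ V, m * a = 0) → a = 0) 
    (S : Set V) (hS : LO (K := K) S) (hne : S.Nonempty)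
    (hk : ∀ l ∈ S, ∃ k : V, k ≠ 0 ∧ (l : A) * k = 0) (n : ℕ) :
    ∃ l k : ℕ → V, (∀ i < n, l i ∈ S) ∧ (∀ i < n, k i ≠ 0) ∧ (∀ i < n, (l i : A) * k i = 0) ∧
      ∀ i j, i < j → j < n → (l j : A) * k i ≠ 0 := by
  induction n with
  | zero => exact ⟨0, 0, by simp, by simp, by simp, by simp⟩
  | succ n ih =>
    obtain ⟨l, k, h1, h2, h3, h4⟩ := ih
    have : ∀ m ≤ n, ∃ x ∈ S, ∀ i < m, (x : A) * k i ≠ 0 := by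
      intro m
      induction m with
      | zero => intro _; exact ⟨hne.some, hne.some_mem, by simp⟩
      | succ m ihm =>
        intro hm
        obtain ⟨x, hx, hxm⟩ := ihm (by omega)
        obtain ⟨y, hy⟩ : ∃ y : V, (y : A) * k m ≠ 0 := by
          by_contra h
          push Not at h
          refine h2 m (by omega) ?_
          have := hnd 1 (by omega) (k m : A) (by simp) fun z hz => h ⟨z, hz⟩
          exact Subtype.ext this
        have lo : ∀ c : V, LO (K := K) {z : V | (z : A) * c ≠ 0} := by
          intro c z hz w
          refine (poly_finite ((Polynomial.C (z : A) + Polynomial.X * Polynomial.C (w : A)) *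
            Polynomial.C (c : A)) ?_).subset ?_
          · intro h
            have := congrArg (Polynomial.eval 0) h
            simp at this
            exact hz this
          · intro t ht
            simp only [Set.mem_ofPred_eq, not_not] at ht ⊢
            simpa [Algebra.smul_def, mul_comm (algebraMap K A t)] using ht
        have fin1 := hS x hx (y - x)
        have fin2 : {t : K | ∃ i < m, ¬ ((x + t • (y - x) : V) : A) * k i ≠ 0}.Finite := by
          have : {t : K | ∃ i < m, ¬ ((x + t • (y - x) : V) : A) * k i ≠ 0} =
            ⋃ i ∈ Finset.range m, {t : K | x + t • (y - x) ∉ {z : V | (z : A) * k i ≠ 0}} := by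
            ext t; simp
          rw [this]
          refine Set.Finite.biUnion (Finset.finite_toSet _) fun i hi => ?_
          exact lo (k i) x (hxm i (by simpa using hi)) _
        have fin3 := (lo (k m) y hy (x - y)).image (fun t => 1 - t)
        obtain ⟨t, ht⟩ := ((fin1.union fin2).union fin3).exists_notMem
        simp only [Set.mem_union, Set.mem_ofPred_eq, Set.mem_image, not_or, not_not, not_exists,
          not_and] at ht
        obtain ⟨⟨ht1, ht2⟩, ht3⟩ := ht
        refine ⟨x + t • (y - x), ht1, fun i hi => ?_⟩
        rcases Nat.lt_succ_iff_lt_or_eq.1 hi with hi | rfl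
        · exact ht2 i hi
        · intro h
          refine ht3 (1 - t) ?_ (by ring)
          rw [← h]
          congr 2
          module
    obtain ⟨x, hx, hxk⟩ := this n le_rfl
    obtain ⟨c, hc0, hc⟩ := hk x hx
    refine ⟨fun i => if i < n then l i else x, fun i => if i < n then k i else c, ?_, ?_, ?_, ?_⟩
    · intro i hi; by_cases h : i < n <;> simp [h, h1, hx]
    · intro i hi; by_cases h : i < n <;> simp [h, h2, hc0]
    · intro i hi; by_cases h : i < n <;> simp [h, h3, hc]
    · intro i j hij hj
      have hi : i < n := by omega
      by_cases h : j < n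
      · simpa [h, hi] using h4 i j hij h
      · simpa [h, hi] using hxk i hi

theorem exists_inj [CharZero K] (V : Submodule K A) (d : ℕ) (hd : 4 ≤ d)
    (hnd : ∀ i < d, ∀ a ∈ V ^ i, (∀ m ∈ V, m * a = 0) → a = 0) (hV : Module.finrank K V = 5)
    (hVd : Module.finrank K (V ^ d : Submodule K A) = 1) :
    ∃ l : V, (l : A) ^ d ≠ 0 ∧ Function.Injective (mu V l) := by
  classical
  by_contra hcon
  push Not at hcon
  have hfd : FiniteDimensional K V := Module.finite_of_finrank_pos (by omega)
  have hVb : V ≠ ⊥ := by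
    rintro rfl
    simp at hV
  obtain ⟨x0, hx0⟩ := exists_pow_ne V d (by omega) hnd hVb
  have hS := (LO_MR V).inter (LO_pow V d)
  have hSne := LO.nonempty (LO_MR V) (LO_pow V d) (MR_nonempty V) ⟨x0, hx0⟩
  obtain ⟨l, k, h1, h2, h3, h4⟩ := exists_four V d hd hnd _ hS hSne (by
    rintro l ⟨_, hl⟩
    have := hcon l hl
    rw [← LinearMap.ker_eq_bot, ← ne_eq, Submodule.ne_bot_iff] at this
    obtain ⟨k, hk, hk0⟩ := this
    exact ⟨k, hk0, hk⟩) 4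
  have hA : ∀ i : Fin 4, (k i : A) * k i = 0 ∧ Module.finrank K (LinearMap.range (mu V (k i))) ≤ 1 :=
    fun i => stepA V d hd hnd hV (l i) (k i) (h1 i i.2).1 (h1 i i.2).2 (h2 i i.2) (h3 i i.2)
  have hB := fun i : Fin 4 => stepB V d hd hnd (k i) (h2 i i.2) (hA i).2
  choose f b hfb hf hpow using hB
  have hNP0 : ∀ i j : Fin 4, i < j → ∀ x y : K, x • k i + y • k j = 0 → x = 0 ∧ y = 0 := by
    intro i j hij x y h
    have hx : x = 0 := by
      have := congrArg (fun z : V => (l j : A) * (z : A)) h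
      simp only [Submodule.coe_add, Submodule.coe_smul, mul_add, mul_smul_comm, h3 j j.2,
        smul_zero, add_zero, Submodule.coe_zero, mul_zero] at this
      exact (smul_eq_zero.1 this).resolve_right (h4 i j hij j.2)
    subst hx
    rw [zero_smul, zero_add] at h
    exact ⟨rfl, (smul_eq_zero.1 h).resolve_right (h2 j j.2)⟩
  have hNP : ∀ i j : Fin 4, i ≠ j → ∀ x y : K, x • k i + y • k j = 0 → x = 0 ∧ y = 0 := by
    intro i j hij x y h
    rcases lt_or_gt_of_ne hij with h' | h'
    · exact hNP0 i j h' x y h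
    · rw [add_comm] at h
      exact (hNP0 j i h' y x h).symm
  have hC : ∀ i j : Fin 4, ∃ a : V, i ≠ j → f i a = 0 ∧ f j a ≠ 0 := by
    intro i j
    by_cases hij : i = j
    · exact ⟨0, fun h => absurd hij h⟩
    · obtain ⟨a, ha⟩ := stepC V d hd hnd hVd (k i) (k j) (b i) (b j) (f i) (f j) (hfb j) (hf i) (hf j)
        (hNP i j hij)
      exact ⟨a, fun _ => ha⟩
  choose a ha using hC
  have hD : ∀ i j : Fin 4, f j (k i) = 0 := by
    intro i j
    by_cases hij : i = j
    · subst hij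
      have := (hA i).1
      rw [hf i (k i)] at this
      exact (smul_eq_zero.1 this).resolve_right (by simpa using hpow i 1 (by omega))
    · obtain ⟨ha1, ha2⟩ := ha i j hij
      have e1 : (k i : A) * a i j = 0 := by rw [hf i, ha1, zero_smul]
      have e2 := prod_rank_one V (k j) (b j) (f j) (hf j) (Finset.univ : Finset (Fin 2)) ![k i, a i j]
      simp only [Fin.prod_univ_two, Matrix.cons_val_zero, Matrix.cons_val_one, e1, mul_zero,
        Finset.card_univ, Fintype.card_fin] at e2
      have := (smul_eq_zero.1 e2.symm).resolve_right (hpow j 2 (by omega))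
      exact (mul_eq_zero.1 this).resolve_right ha2
  have hE : LinearIndependent K (fun i : Fin 4 => k i) := by
    rw [Fintype.linearIndependent_iff]
    intro c hc j
    have e0 : ∑ i : Fin 4, c i • (k i : A) = 0 := by
      have := congrArg (fun z : V => (z : A)) hc
      simpa using this
    have e1 := congrArg (fun z => z * ∏ i ∈ Finset.univ.erase j, (a i j : A)) e0
    simp only [Finset.sum_mul, smul_mul_assoc, zero_mul] at e1
    rw [Finset.sum_eq_single j] at e1
    · rw [prod_rank_one V (k j) (b j) (f j) (hf j), smul_smul] at e1
      have := (smul_eq_zero.1 e1).resolve_right (hpow j _ (by simp; omega))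
      refine (mul_eq_zero.1 this).resolve_right ?_
      rw [← ne_eq, Finset.prod_ne_zero_iff]
      intro i hi
      exact (ha i j (Finset.ne_of_mem_erase hi)).2
    · intro i _ hij
      have : i ∈ Finset.univ.erase j := by simp [hij]
      rw [← Finset.mul_prod_erase _ _ this, ← mul_assoc, hf i, (ha i j hij).1]
      simp
    · simp
  -- final dimension count
  have hsp := finrank_span_eq_card hE
  let g : V →ₗ[K] K × K := (f 0).prod (f 1)
  have hle : Submodule.span K (Set.range fun i : Fin 4 => k i) ≤ LinearMap.ker g := by
    rw [Submodule.span_le]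
    rintro _ ⟨i, rfl⟩
    simp [g, hD]
  have hsurj : LinearMap.range g = ⊤ := by
    rw [LinearMap.range_eq_top]
    rintro ⟨x, y⟩
    obtain ⟨p1, p2⟩ := ha 0 1 (by decide)
    obtain ⟨q1, q2⟩ := ha 1 0 (by decide)
    refine ⟨(x * (f 0 (a 1 0))⁻¹) • a 1 0 + (y * (f 1 (a 0 1))⁻¹) • a 0 1, ?_⟩
    simp [g, p1, q1, p2, q2]
  have r1 := LinearMap.finrank_range_add_finrank_ker g
  have r2 := Submodule.finrank_mono hle
  rw [hsurj, finrank_top, Module.finrank_prod, Module.finrank_self] at r1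
  rw [hsp, Fintype.card_fin] at r2
  omega
end core

section slp
variable {K A : Type*} [Field K] [CommRing A] [Algebra K A]

theorem slp_abstract [CharZero K] (V : Submodule K A) (d : ℕ) (hd : d = 2 ∨ 4 ≤ d)
    (hnd : ∀ i < d, ∀ a ∈ V ^ i, (∀ m ∈ V, m * a = 0) → a = 0)
    (hmid : ∀ i : ℕ, 1 ≤ i → i ≤ d - 1 → Module.finrank K (V ^ i : Submodule K A) = 5)
    (hVd : Module.finrank K (V ^ d : Submodule K A) = 1)
    (htop : ∀ i, d < i → V ^ i = ⊥) :
    ∃ l ∈ V, ∀ i k : ℕ, 1 ≤ k → (∀ a ∈ V ^ i, l ^ k * a = 0 → a = 0) ∨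
      (∀ b ∈ V ^ (i + k), ∃ a ∈ V ^ i, l ^ k * a = b) := by
  have hV : Module.finrank K V = 5 := by
    have := hmid 1 le_rfl (by omega)
    rwa [pow_one] at this
  have hVb : V ≠ ⊥ := by
    rintro rfl
    simp at hV
  have hfd : FiniteDimensional K V := Module.finite_of_finrank_pos (by omega)
  obtain ⟨l, hl, hs⟩ : ∃ l : V, (l : A) ^ d ≠ 0 ∧
      ∀ i, 1 ≤ i → ∀ b ∈ V ^ (i + 1), ∃ a ∈ V ^ i, (l : A) * a = b := by
    rcases hd with rfl | hd
    · obtain ⟨l, hl⟩ := exists_pow_ne V 2 (by omega) hnd hVb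
      refine ⟨l, hl, fun i hi b hb => ?_⟩
      rcases eq_or_lt_of_le hi with rfl | hi
      · obtain ⟨c, hc⟩ := (finrank_eq_one_iff_of_nonzero' (⟨(l : A) ^ 2, Submodule.pow_mem_pow V l.2 2⟩ :
          (V ^ 2 : Submodule K A)) (by simpa [Subtype.ext_iff] using hl)).1 hVd ⟨b, hb⟩
        refine ⟨c • l, by rw [pow_one]; exact V.smul_mem c l.2, ?_⟩
        have := congrArg (Submodule.subtype _) hc
        simp only [map_smul, Submodule.subtype_apply] at this
        rw [← this, mul_smul_comm, pow_two]
      · rw [htop _ (by omega)] at hb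
        exact ⟨0, Submodule.zero_mem _, by simpa using ((Submodule.mem_bot K).1 hb).symm⟩
    · obtain ⟨l, hl, hinj⟩ := exists_inj V d hd hnd hV hVd
      refine ⟨l, hl, ?_⟩
      have hr : LinearMap.range (mu V l) = V ^ 2 := by
        have h2 := hmid 2 (by omega) (by omega)
        have : FiniteDimensional K (V ^ 2 : Submodule K A) :=
          Module.finite_of_finrank_pos (by omega)
        refine Submodule.eq_of_le_of_finrank_eq ?_ ?_
        · rintro _ ⟨x, rfl⟩
          rw [pow_two]
          exact Submodule.mul_mem_mul l.2 x.2
        · rw [LinearMap.finrank_range_of_inj hinj, hV, h2]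
      intro i hi
      induction i, hi using Nat.le_induction with
      | base =>
        intro b hb
        rw [show 1 + 1 = 2 from rfl, ← hr] at hb
        obtain ⟨a, rfl⟩ := hb
        exact ⟨a, by simp, rfl⟩
      | succ i hi ih =>
        intro b hb
        rw [pow_succ] at hb
        induction hb using Submodule.mul_induction_on' with
        | mem_mul_mem x hx y hy =>
          obtain ⟨a, ha, rfl⟩ := ih x hx
          exact ⟨a * y, by rw [pow_succ]; exact Submodule.mul_mem_mul ha hy, by ring⟩
        | add x hx y hy h1 h2 =>
          obtain ⟨a, ha, rfl⟩ := h1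
          obtain ⟨a', ha', rfl⟩ := h2
          exact ⟨a + a', Submodule.add_mem _ ha ha', by ring⟩
  refine ⟨l, l.2, fun i k hk => ?_⟩
  rcases Nat.eq_zero_or_pos i with rfl | hi
  · by_cases hkd : k ≤ d
    · left
      intro a ha h
      rw [pow_zero, Submodule.mem_one] at ha
      obtain ⟨c, rfl⟩ := ha
      have h1 : c • (l : A) ^ k = 0 := by rw [Algebra.smul_def, mul_comm]; exact h
      rcases smul_eq_zero.1 h1 with h2 | h2
      · rw [h2, map_zero]
      · exact absurd (pow_eq_zero_of_le hkd h2) hl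
    · right
      intro b hb
      rw [htop _ (by omega)] at hb
      exact ⟨0, Submodule.zero_mem _, by simpa using ((Submodule.mem_bot K).1 hb).symm⟩
  · right
    clear hk
    induction k with
    | zero => intro b hb; exact ⟨b, hb, by simp⟩
    | succ k ih =>
      intro b hb
      obtain ⟨a, ha, rfl⟩ := hs (i + k) (by omega) b hb
      obtain ⟨a', ha', rfl⟩ := ih a ha
      exact ⟨a', ha', by ring⟩
end slp

lemma piece_eq_pow {K : Type*} [Field K] {n : ℕ} (I : Ideal (MvPolynomial (Fin n) K)) (i : ℕ) :
    piece I i = piece I 1 ^ i := by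
  unfold piece
  rw [← homogeneousSubmodule_one_pow _ i]
  exact Submodule.map_pow _ _ _

lemma piece_disj {K : Type*} [Field K] {n : ℕ} (I : Ideal (MvPolynomial (Fin n) K))
    (hI : IsHomogIdeal I) (i j : ℕ) (hij : i ≠ j) (a : MvPolynomial (Fin n) K ⧸ I)
    (hi : a ∈ piece I i) (hj : a ∈ piece I j) : a = 0 := by
  obtain ⟨p, hp, rfl⟩ := hi
  obtain ⟨q, hq, hpq⟩ := hj
  have h1 : Ideal.Quotient.mk I q = Ideal.Quotient.mk I p := hpq
  rw [Ideal.Quotient.eq] at h1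
  have h2 := hI _ h1 i
  rw [map_sub, homogeneousComponent_of_mem hp, homogeneousComponent_of_mem hq, if_pos rfl,
    if_neg hij, zero_sub, neg_mem_iff] at h2
  exact Ideal.Quotient.eq_zero_iff_mem.2 h2

/-- Any artinian Gorenstein algebra with h-vector `(1,5,5,…,5,1)` of socle degree
`d = 2` or `d ≥ 4` has the SLP. -/
theorem slp_1555551 {K : Type*} [Field K] [IsAlgClosed K] [CharZero K] (d : ℕ)
    (hd : d = 2 ∨ 4 ≤ d)
    (I : Ideal (MvPolynomial (Fin 5) K))
    (hAG : IsArtinianGorenstein I d)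
    (h0 : hf I 0 = 1) (hd1 : hf I d = 1)
    (hmid : ∀ i : ℕ, 1 ≤ i → i ≤ d - 1 → hf I i = 5) :
    SLP I := by
  obtain ⟨hI, -, hvan, -, -, hsoc⟩ := hAG
  have hfin : FiniteDimensional K (piece I 1) := by
    refine Module.finite_of_finrank_pos ?_
    have := hmid 1 le_rfl (by omega)
    unfold hf at this
    omega
  have hnd : ∀ i < d, ∀ a ∈ piece I 1 ^ i, (∀ m ∈ piece I 1, m * a = 0) → a = 0 := by
    intro i hi a ha h
    rw [← piece_eq_pow] at ha
    refine piece_disj I hI i d (by omega) a ha (hsoc ?_)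
    unfold socle
    rw [Submodule.mem_iInf]
    intro j
    rw [LinearMap.mem_ker, LinearMap.mulLeft_apply]
    exact h _ ⟨X j, isHomogeneous_X K j, rfl⟩
  obtain ⟨l, hl, hs⟩ := slp_abstract (piece I 1) d hd hnd
    (fun i h1 h2 => by rw [← piece_eq_pow]; exact hmid i h1 h2)
    (by rw [← piece_eq_pow]; exact hd1)
    (fun i hi => by
      have hfi : FiniteDimensional K (piece I 1 ^ i : Submodule K (MvPolynomial (Fin 5) K ⧸ I)) := by
        exact Module.Finite.iff_fg.2 ((Module.Finite.iff_fg.1 hfin).pow i)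
      have := hvan i hi
      unfold hf at this
      rw [piece_eq_pow] at this
      exact Submodule.finrank_eq_zero.1 this)
  obtain ⟨p, hp, rfl⟩ := hl
  refine ⟨p, hp, fun i k hk => ?_⟩
  rw [piece_eq_pow I i, piece_eq_pow I (i + k)]
  exact hs i k hk
end
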